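/- arXiv:2209.00646 — 4 statements merged into one kernel-verified Lean document; each statement's English description precedes it below -/
import Mathlib

section
/- Let ℋ be a finite-dimensional complex Hilbert space, κ > 0, and f a κ-function. Then: (a) (α, ρ, σ) ↦ D_α^meas(ρ‖σ) is continuous on (0,1) × {nonzero PSD operators on ℋ}²; (b) (α, ρ, σ) ↦ D_α^meas(ρ‖σ) is continuous on {α ∈ (1,∞) : (1−κ)α < 1} × (B(ℋ)×B(ℋ))_f; (c) for every fixed α ∈ (0,∞) with (1−κ)α < 1 (including α = 1), (ρ, σ) ↦ D_α^meas(ρ‖σ) is continuous on (B(ℋ)×B(ℋ))_f, and for α ∈ (0,1) it is continuous on all pairs of nonzero PSD operators; (d) for any fixed nonzero PSD ρ, σ, the function α ↦ (α−1)·D_α^meas(ρ‖σ) + log Tr ρ is convex on (1,∞), and α ↦ D_α^meas(ρ‖σ) is monotone increasing and continuous on (0,∞). -/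
open Filter Set Topology
open scoped ComplexOrder

noncomputable section

namespace QRenyi

attribute [local instance] Classical.propDecidable

variable {ι : Type*} [Fintype ι] [DecidableEq ι]

/-- Apply a real function to the eigenvalues of a Hermitian matrix (functional calculus);
junk value `0` for non-Hermitian matrices. -/
noncomputable def hermApply (f : ℝ → ℝ) (A : Matrix ι ι ℂ) : Matrix ι ι ℂ :=
  if hA : A.IsHermitian then hA.cfc f else 0

/-- Real power of a positive semidefinite matrix, taken on its support:
`t ↦ t ^ x` is applied to the nonzero eigenvalues and `0` is mapped to `0`.
In particular `matPow A 0` is the support projection of `A`. -/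
noncomputable def matPow (A : Matrix ι ι ℂ) (x : ℝ) : Matrix ι ι ℂ :=
  hermApply (fun t => if t = 0 then 0 else t ^ x) A

/-- Logarithm of a positive semidefinite matrix taken on its support
(`Real.log 0 = 0` in Mathlib, matching the convention `log̃ 0 = 0`). -/
noncomputable def matLog (A : Matrix ι ι ℂ) : Matrix ι ι ℂ :=
  hermApply Real.log A

/-- `supp ρ ≤ supp σ`, expressed (for PSD matrices) as inclusion of kernels. -/
def suppLE (ρ σ : Matrix ι ι ℂ) : Prop :=
  ∀ v : ι → ℂ, σ.mulVec v = 0 → ρ.mulVec v = 0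

/-- The Loewner (positive semidefinite) order. -/
def loewnerLE (A B : Matrix ι ι ℂ) : Prop := (B - A).PosSemidef

/-- Real part of the trace. -/
noncomputable def reTrace (A : Matrix ι ι ℂ) : ℝ := A.trace.re

/-- The trace quantity `Tr ((σ^{(1-α)/(2z)} ρ^{α/z} σ^{(1-α)/(2z)})^z)` (a real number). -/
noncomputable def Qaz (α z : ℝ) (ρ σ : Matrix ι ι ℂ) : ℝ :=
  reTrace (matPow (matPow σ ((1 - α) / (2 * z)) * matPow ρ (α / z) *
    matPow σ ((1 - α) / (2 * z))) z)

/-- The Rényi `(α,z)`-divergence (for `α ≠ 1`), with values in `EReal = ℝ ∪ {±∞}`.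
It equals `(α-1)⁻¹ (log Q_{α,z}(ρ‖σ) - log Tr ρ)`; it is `+∞` when `α > 1` and
`supp ρ ≰ supp σ`, and also `+∞` when `α < 1` and `Q_{α,z}(ρ‖σ) = 0`
(i.e. `(α-1)⁻¹ log 0 = +∞`). -/
noncomputable def Daz (α z : ℝ) (ρ σ : Matrix ι ι ℂ) : EReal :=
  if (suppLE ρ σ ∨ α < 1) ∧ Qaz α z ρ σ ≠ 0 then
    (((α - 1)⁻¹ * (Real.log (Qaz α z ρ σ) - Real.log (reTrace ρ)) : ℝ) : EReal)
  else ⊤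

/-- The (normalized) Umegaki relative entropy. -/
noncomputable def DUm (ρ σ : Matrix ι ι ℂ) : EReal :=
  if suppLE ρ σ then
    (((reTrace ρ)⁻¹ * reTrace (ρ * (matLog ρ - matLog σ)) : ℝ) : EReal)
  else ⊤

/-- The Rényi `(α,z)`-divergence, with `D_{1,z} := D^Um`. -/
noncomputable def Dfull (α z : ℝ) (ρ σ : Matrix ι ι ℂ) : EReal :=
  if α = 1 then DUm ρ σ else Daz α z ρ σ

/-- The max-relative entropy `D_max(ρ‖σ) = log inf {λ > 0 : ρ ≤ λ σ}`. -/
noncomputable def Dmax (ρ σ : Matrix ι ι ℂ) : EReal :=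
  if ∃ c : ℝ, 0 < c ∧ loewnerLE ρ (c • σ) then
    ((Real.log (sInf {c : ℝ | 0 < c ∧ loewnerLE ρ (c • σ)}) : ℝ) : EReal)
  else ⊤

/-- The classical quantity `Q_α^cl(ρ‖σ) = ∑_x ρ(x)^α σ(x)^{1-α}` (with `0^t = 0` for `t ≠ 0`). -/
noncomputable def Qcl {X : Type*} [Fintype X] (α : ℝ) (ρ σ : X → ℝ) : ℝ :=
  ∑ x, ρ x ^ α * σ x ^ (1 - α)

/-- Absolute continuity `ρ ≪ σ` for functions on a finite set. -/
def acl {X : Type*} (ρ σ : X → ℝ) : Prop := ∀ x, σ x = 0 → ρ x = 0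

/-- The classical Rényi `α`-divergence, with values in `EReal`; for `α = 1` it is the
(normalized) Kullback-Leibler divergence. -/
noncomputable def Dcl {X : Type*} [Fintype X] (α : ℝ) (ρ σ : X → ℝ) : EReal :=
  if α = 1 then
    (if acl ρ σ then
      ((((∑ x, ρ x)⁻¹ * ∑ x, ρ x * (Real.log (ρ x) - Real.log (σ x))) : ℝ) : EReal)
     else ⊤)
  else if (acl ρ σ ∨ α < 1) ∧ Qcl α ρ σ ≠ 0 then
    ((((α - 1)⁻¹ * (Real.log (Qcl α ρ σ) - Real.log (∑ x, ρ x))) : ℝ) : EReal)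
  else ⊤

/-- The measured Rényi `α`-divergence: supremum over all finite-outcome POVMs. -/
noncomputable def Dmeas (α : ℝ) (ρ σ : Matrix ι ι ℂ) : EReal :=
  ⨆ (k : ℕ) (M : Fin k → Matrix ι ι ℂ)
    (_ : (∀ i, (M i).PosSemidef) ∧ ∑ i, M i = 1),
    Dcl α (fun i => reTrace (M i * ρ)) (fun i => reTrace (M i * σ))

/-- A `κ`-function: a continuous nonnegative function on `[0,∞)` with
`limsup_{x→0⁺} f(x) x^{-κ} < ∞`. -/
def IsKappaFunction (κ : ℝ) (f : ℝ → ℝ) : Prop :=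
  ContinuousOn f (Set.Ici 0) ∧ (∀ x ∈ Set.Ici (0 : ℝ), 0 ≤ f x) ∧
    ∃ M : ℝ, ∀ᶠ x in 𝓝[>] (0 : ℝ), f x ≤ M * x ^ κ

/-- A strict `κ`-function: a `κ`-function with `liminf_{x→0⁺} f(x) x^{-κ} > 0`. -/
def IsStrictKappaFunction (κ : ℝ) (f : ℝ → ℝ) : Prop :=
  IsKappaFunction κ f ∧ ∃ c : ℝ, 0 < c ∧ ∀ᶠ x in 𝓝[>] (0 : ℝ), c * x ^ κ ≤ f x

/-- Nonzero PSD matrix predicate. -/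
def PSDne (A : Matrix ι ι ℂ) : Prop := A.PosSemidef ∧ A ≠ 0

section Classical

variable {X : Type*} [Fintype X] {p q : X → ℝ}

lemma sum_rpow_mul_rpow_le (x y : X → ℝ) (hx : ∀ i, 0 ≤ x i) (hy : ∀ i, 0 ≤ y i) {t : ℝ}
    (ht0 : 0 < t) (ht1 : t < 1) :
    ∑ i, x i ^ t * y i ^ (1 - t) ≤ (∑ i, x i) ^ t * (∑ i, y i) ^ (1 - t) := by
  have ht1' : 0 < 1 - t := by linarith
  have hX : 0 ≤ ∑ i, x i := Finset.sum_nonneg fun i _ => hx i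
  have hY : 0 ≤ ∑ i, y i := Finset.sum_nonneg fun i _ => hy i
  rcases hX.eq_or_lt with hX0 | hX0
  · have h0 : ∀ i, x i = 0 := fun i =>
      (Finset.sum_eq_zero_iff_of_nonneg fun i _ => hx i).1 hX0.symm i (Finset.mem_univ i)
    simp [h0, Real.zero_rpow ht0.ne']
  rcases hY.eq_or_lt with hY0 | hY0
  · have h0 : ∀ i, y i = 0 := fun i =>
      (Finset.sum_eq_zero_iff_of_nonneg fun i _ => hy i).1 hY0.symm i (Finset.mem_univ i)
    simp [h0, Real.zero_rpow ht1'.ne']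
  have hpos : 0 < (∑ i, x i) ^ t * (∑ i, y i) ^ (1 - t) := by positivity
  have key : ∀ i, x i ^ t * y i ^ (1 - t) ≤ ((∑ i, x i) ^ t * (∑ i, y i) ^ (1 - t)) *
      (t * (x i / ∑ i, x i) + (1 - t) * (y i / ∑ i, y i)) := by
    intro i
    have h := Real.geom_mean_le_arith_mean2_weighted ht0.le ht1'.le
      (div_nonneg (hx i) hX) (div_nonneg (hy i) hY) (by ring)
    rw [Real.div_rpow (hx i) hX, Real.div_rpow (hy i) hY, div_mul_div_comm,
      div_le_iff₀ hpos] at h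
    linarith
  calc _ ≤ _ := Finset.sum_le_sum fun i _ => key i
    _ = _ := by
      rw [← Finset.mul_sum, Finset.sum_add_distrib, ← Finset.mul_sum, ← Finset.mul_sum,
        ← Finset.sum_div, ← Finset.sum_div, div_self hX0.ne', div_self hY0.ne']
      ring

lemma Qcl_nonneg (hp : ∀ x, 0 ≤ p x) (hq : ∀ x, 0 ≤ q x) (α : ℝ) : 0 ≤ Qcl α p q :=
  Finset.sum_nonneg fun x _ => mul_nonneg (Real.rpow_nonneg (hp x) _) (Real.rpow_nonneg (hq x) _)

lemma Dcl_le_iff_of_lt_one (hp : ∀ x, 0 ≤ p x) (hq : ∀ x, 0 ≤ q x) (hP : 0 < ∑ x, p x)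
    {α : ℝ} (hα : α < 1) (y : ℝ) :
    Dcl α p q ≤ (y : EReal) ↔ (∑ x, p x) * Real.exp ((α - 1) * y) ≤ Qcl α p q := by
  unfold Dcl
  rw [if_neg hα.ne]
  rcases (Qcl_nonneg hp hq α).eq_or_lt with h0 | h0
  · rw [← h0]
    simp only [ne_eq, not_true_eq_false, and_false, if_false, top_le_iff, EReal.coe_ne_top,
      false_iff, not_le]
    positivity
  · rw [if_pos ⟨Or.inr hα, h0.ne'⟩, EReal.coe_le_coe_iff, ← Real.log_le_log_iff (by positivity) h0,
      Real.log_mul hP.ne' (Real.exp_pos _).ne', Real.log_exp, inv_mul_eq_div, div_le_iff_of_neg (by linarith)]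
    constructor <;> intro h <;> linarith

lemma Qcl_pos_of_acl (hp : ∀ x, 0 ≤ p x) (hq : ∀ x, 0 ≤ q x) (hP : 0 < ∑ x, p x)
    (hac : acl p q) (α : ℝ) : 0 < Qcl α p q := by
  obtain ⟨x, -, hx⟩ : ∃ x ∈ (Finset.univ : Finset X), 0 < p x :=
    Finset.exists_lt_of_sum_lt (by simpa using hP)
  have hqx : 0 < q x := (hq x).lt_of_ne fun h => hx.ne' (hac x h.symm)
  exact Finset.sum_pos' (fun x _ => mul_nonneg (Real.rpow_nonneg (hp x) _)
    (Real.rpow_nonneg (hq x) _)) ⟨x, Finset.mem_univ x, by positivity⟩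

lemma Dcl_le_iff_of_one_lt (hp : ∀ x, 0 ≤ p x) (hq : ∀ x, 0 ≤ q x) (hP : 0 < ∑ x, p x)
    (hac : acl p q) {α : ℝ} (hα : 1 < α) (y : ℝ) :
    Dcl α p q ≤ (y : EReal) ↔ Qcl α p q ≤ (∑ x, p x) * Real.exp ((α - 1) * y) := by
  have h0 := Qcl_pos_of_acl hp hq hP hac α
  unfold Dcl
  rw [if_neg hα.ne', if_pos ⟨Or.inl hac, h0.ne'⟩, EReal.coe_le_coe_iff,
    ← Real.log_le_log_iff h0 (by positivity), Real.log_mul hP.ne' (Real.exp_pos _).ne',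
    Real.log_exp, inv_mul_le_iff₀ (by linarith)]
  constructor <;> intro h <;> linarith

lemma Dcl_one_le_iff (hP : 0 < ∑ x, p x) (hac : acl p q) (y : ℝ) :
    Dcl 1 p q ≤ (y : EReal) ↔
      ∑ x, p x * (Real.log (p x) - Real.log (q x)) ≤ (∑ x, p x) * y := by
  unfold Dcl
  rw [if_pos rfl, if_pos hac, EReal.coe_le_coe_iff, inv_mul_le_iff₀ hP]

lemma Dcl_eq_top_of_not_acl (hac : ¬ acl p q) {α : ℝ} (hα : 1 ≤ α) : Dcl α p q = ⊤ := by
  unfold Dcl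
  by_cases h : α = 1
  · rw [if_pos h, if_neg hac]
  · rw [if_neg h, if_neg]
    rintro ⟨h1 | h1, -⟩
    · exact hac h1
    · linarith

lemma Dcl_ne_bot (α : ℝ) : Dcl α p q ≠ ⊥ := by
  unfold Dcl
  split_ifs <;> first | exact EReal.coe_ne_bot _ | exact top_ne_bot

lemma rpow_mul_rpow_eq {a b α : ℝ} (ha : 0 ≤ a) (hb : 0 ≤ b) (hab : b = 0 → a = 0)
    (hα : α ≠ 0) :
    a ^ α * b ^ (1 - α) = a * Real.exp ((α - 1) * (Real.log a - Real.log b)) := by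
  rcases ha.eq_or_lt with rfl | ha
  · simp [Real.zero_rpow hα]
  · have hb' : 0 < b := hb.lt_of_ne fun h => ha.ne' (hab h.symm)
    conv_rhs => rw [← Real.exp_log ha]
    rw [Real.rpow_def_of_pos ha, Real.rpow_def_of_pos hb', ← Real.exp_add, ← Real.exp_add,
      Real.exp_log ha]
    congr 1; ring

lemma Qcl_eq_of_acl (hp : ∀ x, 0 ≤ p x) (hq : ∀ x, 0 ≤ q x) (hac : acl p q) {α : ℝ}
    (hα : α ≠ 0) :
    Qcl α p q = ∑ x, p x * Real.exp ((α - 1) * (Real.log (p x) - Real.log (q x))) :=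
  Finset.sum_congr rfl fun x _ => rpow_mul_rpow_eq (hp x) (hq x) (hac x) hα

/-- Jensen's inequality for the exponential, in terms of the relative entropy. -/
lemma exp_relEntropy_le_Qcl (hp : ∀ x, 0 ≤ p x) (hq : ∀ x, 0 ≤ q x) (hP : 0 < ∑ x, p x)
    (hac : acl p q) {α : ℝ} (hα : α ≠ 0) :
    (∑ x, p x) * Real.exp ((α - 1) *
      ((∑ x, p x * (Real.log (p x) - Real.log (q x))) / ∑ x, p x)) ≤ Qcl α p q := by
  rw [Qcl_eq_of_acl hp hq hac hα]
  set P := ∑ x, p x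
  set S := ∑ x, p x * (Real.log (p x) - Real.log (q x)) with hS
  set c := (α - 1) * (S / P) with hc
  have hcP : c * P = (α - 1) * S := by rw [hc]; field_simp
  have key : ∀ x, p x * (Real.exp c * (1 + (α - 1) * (Real.log (p x) - Real.log (q x)) - c)) ≤
      p x * Real.exp ((α - 1) * (Real.log (p x) - Real.log (q x))) := by
    intro x
    refine mul_le_mul_of_nonneg_left ?_ (hp x)
    have h := Real.add_one_le_exp ((α - 1) * (Real.log (p x) - Real.log (q x)) - c)
    calc _ ≤ Real.exp c * Real.exp ((α - 1) * (Real.log (p x) - Real.log (q x)) - c) := by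
          refine mul_le_mul_of_nonneg_left ?_ (Real.exp_pos _).le
          linarith
      _ = _ := by rw [← Real.exp_add]; congr 1; ring
  refine le_trans (le_of_eq ?_) (Finset.sum_le_sum fun x _ => key x)
  have : ∀ x, p x * (Real.exp c * (1 + (α - 1) * (Real.log (p x) - Real.log (q x)) - c)) =
      Real.exp c * ((1 - c) * p x + (α - 1) * (p x * (Real.log (p x) - Real.log (q x)))) :=
    fun x => by ring
  simp_rw [this]
  rw [← Finset.mul_sum, Finset.sum_add_distrib, ← Finset.mul_sum, ← Finset.mul_sum, ← hS]
  linear_combination Real.exp c * hcP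

lemma Qcl_interpolate (hp : ∀ x, 0 ≤ p x) (hq : ∀ x, 0 ≤ q x)
    {a b t : ℝ} (ht0 : 0 < t) (ht1 : t < 1)
    (h : ∀ x, p x ^ (t * a + (1 - t) * b) * q x ^ (1 - (t * a + (1 - t) * b)) ≤
      (p x ^ a * q x ^ (1 - a)) ^ t * (p x ^ b * q x ^ (1 - b)) ^ (1 - t)) :
    Qcl (t * a + (1 - t) * b) p q ≤ Qcl a p q ^ t * Qcl b p q ^ (1 - t) := by
  refine le_trans (Finset.sum_le_sum fun x _ => h x) ?_
  exact sum_rpow_mul_rpow_le _ _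
    (fun x => mul_nonneg (Real.rpow_nonneg (hp x) _) (Real.rpow_nonneg (hq x) _))
    (fun x => mul_nonneg (Real.rpow_nonneg (hp x) _) (Real.rpow_nonneg (hq x) _)) ht0 ht1

lemma Qcl_logConvex (hp : ∀ x, 0 ≤ p x) (hq : ∀ x, 0 ≤ q x) (hac : acl p q)
    {a b t : ℝ} (ha : 0 < a) (hb : 0 < b) (ht0 : 0 < t) (ht1 : t < 1) :
    Qcl (t * a + (1 - t) * b) p q ≤ Qcl a p q ^ t * Qcl b p q ^ (1 - t) := by
  have ht1' : 0 < 1 - t := by linarith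
  have hab : 0 < t * a + (1 - t) * b := by positivity
  refine Qcl_interpolate hp hq ht0 ht1 fun x => le_of_eq ?_
  rcases (hp x).eq_or_lt with h | h
  · rw [← h, Real.zero_rpow hab.ne', Real.zero_rpow ha.ne', zero_mul, zero_mul,
      Real.zero_rpow ht0.ne', zero_mul]
  · have hqx : 0 < q x := (hq x).lt_of_ne fun h' => h.ne' (hac x h'.symm)
    rw [Real.mul_rpow (by positivity) (by positivity), Real.mul_rpow (by positivity) (by positivity),
      ← Real.rpow_mul h.le, ← Real.rpow_mul h.le, ← Real.rpow_mul hqx.le, ← Real.rpow_mul hqx.le,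
      mul_mul_mul_comm, ← Real.rpow_add h, ← Real.rpow_add hqx]
    congr 2 <;> ring

lemma Qcl_one_of_acl (hp : ∀ x, 0 ≤ p x) (hq : ∀ x, 0 ≤ q x) (hac : acl p q) :
    Qcl 1 p q = ∑ x, p x := by
  rw [Qcl_eq_of_acl hp hq hac one_ne_zero]; simp

/-- Log-convexity between `a < 1` and the endpoint `1`, without absolute continuity. -/
lemma Qcl_le_rpow_of_lt_one (hp : ∀ x, 0 ≤ p x) (hq : ∀ x, 0 ≤ q x)
    {a t : ℝ} (ha : 0 < a) (ha1 : a < 1) (ht0 : 0 < t) (ht1 : t < 1) :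
    Qcl (t * a + (1 - t)) p q ≤ Qcl a p q ^ t * (∑ x, p x) ^ (1 - t) := by
  have ht1' : 0 < 1 - t := by linarith
  have hab : 0 < t * a + (1 - t) := by positivity
  have hab1 : 0 < 1 - (t * a + (1 - t)) := by nlinarith
  refine le_trans (Finset.sum_le_sum fun x _ => le_of_eq ?_) (sum_rpow_mul_rpow_le _ _
    (fun x => mul_nonneg (Real.rpow_nonneg (hp x) _) (Real.rpow_nonneg (hq x) _)) hp ht0 ht1)
  rcases (hp x).eq_or_lt with h | h
  · rw [← h, Real.zero_rpow hab.ne', Real.zero_rpow ha.ne', zero_mul, zero_mul,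
      Real.zero_rpow ht0.ne', zero_mul]
  · rw [Real.mul_rpow (by positivity) (Real.rpow_nonneg (hq x) _), ← Real.rpow_mul h.le,
      ← Real.rpow_mul (hq x), mul_right_comm, ← Real.rpow_add h]
    congr 2 <;> ring

lemma Dcl_mono (hp : ∀ x, 0 ≤ p x) (hq : ∀ x, 0 ≤ q x) (hP : 0 < ∑ x, p x)
    {a b : ℝ} (ha : 0 < a) (hab : a ≤ b) : Dcl a p q ≤ Dcl b p q := by
  rcases hab.eq_or_lt with rfl | hab
  · exact le_rfl
  have key : ∀ y : ℝ, Dcl b p q ≤ (y : EReal) → Dcl a p q ≤ (y : EReal) := by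
    intro y hy
    by_cases hb1 : b < 1
    · have ha1 : a < 1 := hab.trans hb1
      rw [Dcl_le_iff_of_lt_one hp hq hP hb1] at hy
      rw [Dcl_le_iff_of_lt_one hp hq hP ha1]
      set t := (1 - b) / (1 - a) with ht
      have ha1' : 0 < 1 - a := by linarith
      have htb : t * (1 - a) = 1 - b := by rw [ht]; field_simp
      have ht0 : 0 < t := div_pos (by linarith) ha1'
      have ht1 : t < 1 := by rw [ht, div_lt_one ha1']; linarith
      have h := Qcl_le_rpow_of_lt_one hp hq ha ha1 ht0 ht1
      rw [show t * a + (1 - t) = b by linarith] at h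
      rw [← Real.rpow_le_rpow_iff (by positivity) (Qcl_nonneg hp hq a) ht0,
        ← mul_le_mul_iff_left₀ (show 0 < (∑ x, p x) ^ (1 - t) by positivity)]
      refine le_trans (le_of_eq ?_) (hy.trans h)
      rw [Real.mul_rpow hP.le (Real.exp_pos _).le, mul_right_comm, ← Real.rpow_add hP,
        ← Real.exp_mul]
      rw [show t + (1 - t) = 1 by ring, Real.rpow_one]
      congr 2; linear_combination (-y) * htb
    have hb1' : 1 ≤ b := not_lt.1 hb1
    by_cases hac : acl p q
    swap
    · rw [Dcl_eq_top_of_not_acl hac hb1'] at hy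
      exact absurd (top_le_iff.1 hy) (EReal.coe_ne_top y)
    set P := ∑ x, p x with hPdef
    set S := ∑ x, p x * (Real.log (p x) - Real.log (q x)) with hS
    have hb0 : 0 < b := ha.trans hab
    by_cases ha1 : 1 < a
    · rw [Dcl_le_iff_of_one_lt hp hq hP hac (ha1.trans hab)] at hy
      rw [Dcl_le_iff_of_one_lt hp hq hP hac ha1]
      have hb1' : 0 < b - 1 := by linarith
      set t := (a - 1) / (b - 1) with ht
      have htb : t * (b - 1) = a - 1 := by rw [ht]; field_simp
      have ht0 : 0 < t := div_pos (by linarith) hb1'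
      have ht1 : t < 1 := by rw [ht, div_lt_one hb1']; linarith
      have h := Qcl_logConvex hp hq hac hb0 one_pos ht0 ht1
      rw [Qcl_one_of_acl hp hq hac, show t * b + (1 - t) * 1 = a by linarith] at h
      refine h.trans ?_
      calc Qcl b p q ^ t * P ^ (1 - t) ≤ (P * Real.exp ((b - 1) * y)) ^ t * P ^ (1 - t) := by
            gcongr
            exact Qcl_nonneg hp hq b
        _ = _ := by
          rw [Real.mul_rpow hP.le (Real.exp_pos _).le, mul_right_comm, ← Real.rpow_add hP,
            ← Real.exp_mul]
          rw [show t + (1 - t) = 1 by ring, Real.rpow_one]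
          congr 2; linear_combination y * htb
    have hSy : S ≤ P * y := by
      rcases hb1'.eq_or_lt with hb | hb
      · rw [← hb] at hy
        exact (Dcl_one_le_iff hP hac y).1 hy
      · have h := (exp_relEntropy_le_Qcl hp hq hP hac hb0.ne').trans
          ((Dcl_le_iff_of_one_lt hp hq hP hac hb y).1 hy)
        rw [mul_le_mul_iff_right₀ hP, Real.exp_le_exp, mul_le_mul_iff_right₀ (by linarith),
          div_le_iff₀ hP] at h
        linarith
    rcases (not_lt.1 ha1).eq_or_lt with ha1 | ha1
    · rw [ha1]
      exact (Dcl_one_le_iff hP hac y).2 hSy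
    · rw [Dcl_le_iff_of_lt_one hp hq hP ha1]
      refine le_trans ?_ (exp_relEntropy_le_Qcl hp hq hP hac ha.ne')
      gcongr P * Real.exp ?_
      refine mul_le_mul_of_nonpos_left ?_ (by linarith)
      rw [div_le_iff₀ hP]; linarith
  induction hD : Dcl b p q with
  | bot => exact absurd hD (Dcl_ne_bot b)
  | top => exact le_top
  | coe y => exact key y hD.le

/-- Lower semicontinuity from the left at `α = 1`. -/
lemma eventually_not_Dcl_le (hp : ∀ x, 0 ≤ p x) (hq : ∀ x, 0 ≤ q x) (hP : 0 < ∑ x, p x)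
    {y : ℝ} (hy : ¬ Dcl 1 p q ≤ (y : EReal)) :
    ∀ᶠ α in 𝓝[<] (1 : ℝ), ¬ Dcl α p q ≤ (y : EReal) := by
  have h1 : ∀ᶠ α in 𝓝[<] (1 : ℝ), α < 1 := eventually_mem_nhdsWithin
  have h0 : ∀ᶠ α in 𝓝[<] (1 : ℝ), 0 < α :=
    nhdsWithin_le_nhds (lt_mem_nhds one_pos)
  by_cases hac : acl p q
  · rw [Dcl_one_le_iff hP hac, not_le] at hy
    have hc : Continuous fun α : ℝ => ∑ x, p x * (Real.log (p x) - Real.log (q x)) *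
        Real.exp ((α - 1) * (Real.log (p x) - Real.log (q x))) := by fun_prop
    have hev : ∀ᶠ α in 𝓝[<] (1 : ℝ), (∑ x, p x) * y <
        ∑ x, p x * (Real.log (p x) - Real.log (q x)) *
        Real.exp ((α - 1) * (Real.log (p x) - Real.log (q x))) := by
      refine nhdsWithin_le_nhds (hc.continuousAt.eventually (lt_mem_nhds ?_))
      simpa using hy
    filter_upwards [h1, h0, hev] with α hα1 hα0 hα
    rw [Dcl_le_iff_of_lt_one hp hq hP hα1, not_le, Qcl_eq_of_acl hp hq hac hα0.ne']
    have hle : ∀ x, p x * Real.exp ((α - 1) * (Real.log (p x) - Real.log (q x))) ≤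
        p x + (α - 1) * (p x * (Real.log (p x) - Real.log (q x)) *
        Real.exp ((α - 1) * (Real.log (p x) - Real.log (q x)))) := by
      intro x
      set z := (α - 1) * (Real.log (p x) - Real.log (q x)) with hz
      have h2 : Real.exp z ≤ 1 + z * Real.exp z := by
        have h3 := Real.add_one_le_exp (-z)
        have h4 : Real.exp (-z) * Real.exp z = 1 := by rw [← Real.exp_add]; simp
        nlinarith [Real.exp_pos z]
      have h5 := mul_le_mul_of_nonneg_left h2 (hp x)
      rw [hz] at h5 ⊢
      linarith
    refine (Finset.sum_le_sum fun x _ => hle x).trans_lt ?_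
    rw [Finset.sum_add_distrib, ← Finset.mul_sum]
    have h6 := Real.add_one_le_exp ((α - 1) * y)
    have h7 := mul_le_mul_of_nonneg_left h6 hP.le
    have h8 := mul_lt_mul_of_neg_left hα (show α - 1 < 0 by linarith)
    linarith
  · unfold acl at hac
    push Not at hac
    obtain ⟨x₀, hq0, hp0⟩ := hac
    set F : ℝ → ℝ := fun α => ∑ x, if q x = 0 then 0 else
      p x * Real.exp ((α - 1) * (Real.log (p x) - Real.log (q x))) with hF
    have hc : Continuous F := by
      refine continuous_finsetSum _ fun x _ => ?_
      split_ifs <;> fun_prop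
    have hF1 : F 1 < (∑ x, p x) * Real.exp ((1 - 1) * y) := by
      simp only [hF, sub_self, zero_mul, Real.exp_zero, mul_one]
      have hle : ∀ x ∈ (Finset.univ : Finset X), (if q x = 0 then 0 else p x) ≤ p x := fun x _ => by
        split_ifs
        exacts [hp x, le_rfl]
      refine Finset.sum_lt_sum hle ⟨x₀, Finset.mem_univ _, ?_⟩
      rw [if_pos hq0]
      exact (hp x₀).lt_of_ne hp0.symm
    have hev : ∀ᶠ α in 𝓝[<] (1 : ℝ), F α < (∑ x, p x) * Real.exp ((α - 1) * y) := by
      have hc2 : Continuous fun α : ℝ => (∑ x, p x) * Real.exp ((α - 1) * y) := by fun_prop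
      exact nhdsWithin_le_nhds (hc.continuousAt.eventually_lt hc2.continuousAt hF1)
    filter_upwards [h1, h0, hev] with α hα1 hα0 hα
    rw [Dcl_le_iff_of_lt_one hp hq hP hα1, not_le]
    have hQF : Qcl α p q = F α := by
      refine Finset.sum_congr rfl fun x _ => ?_
      split_ifs with h
      · rw [h, Real.zero_rpow (by linarith), mul_zero]
      · exact rpow_mul_rpow_eq (hp x) (hq x) (fun h' => absurd h' h) hα0.ne'
    rwa [hQF]

/-- Uniform upper bound on `D_{1+s}` for small `s > 0` when `p ≤ c q`. -/
lemma Dcl_one_add_le (hp : ∀ x, 0 ≤ p x) (hq : ∀ x, 0 ≤ q x) (hP : 0 < ∑ x, p x)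
    {c : ℝ} (hc : 1 ≤ c) (hpq : ∀ x, p x ≤ c * q x) {y : ℝ} (hy : Dcl 1 p q ≤ (y : EReal))
    {s : ℝ} (hs : 0 < s) :
    Dcl (1 + s) p q ≤ ((y + (4 * s + c * Real.log c * (Real.exp (s * Real.log c) - 1)) *
      (∑ x, q x) / ∑ x, p x : ℝ) : EReal) := by
  have hac : acl p q := fun x hx => le_antisymm (by simpa [hx] using hpq x) (hp x)
  rw [Dcl_one_le_iff hP hac] at hy
  rw [Dcl_le_iff_of_one_lt hp hq hP hac (by linarith), Qcl_eq_of_acl hp hq hac (by linarith)]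
  set e := 4 * s + c * Real.log c * (Real.exp (s * Real.log c) - 1) with he
  have hlc : 0 ≤ Real.log c := Real.log_nonneg hc
  have he1 : 0 ≤ c * Real.log c * (Real.exp (s * Real.log c) - 1) := by
    have : 1 ≤ Real.exp (s * Real.log c) := Real.one_le_exp (by positivity)
    have : 0 ≤ Real.exp (s * Real.log c) - 1 := by linarith
    positivity
  have key : ∀ x, p x * Real.exp ((1 + s - 1) * (Real.log (p x) - Real.log (q x))) ≤
      p x + s * (p x * (Real.log (p x) - Real.log (q x))) + s * (e * q x) := by
    intro x
    rcases (hp x).eq_or_lt with h | h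
    · rw [← h]
      have := hq x
      simp only [zero_mul, mul_zero, zero_add]
      positivity
    have hqx : 0 < q x := (hq x).lt_of_ne fun h' => h.ne' (hac x h'.symm)
    rw [add_sub_cancel_left]
    set l := Real.log (p x) - Real.log (q x) with hl
    have h2 : Real.exp (s * l) ≤ 1 + s * l * Real.exp (s * l) := by
      have h3 := Real.add_one_le_exp (-(s * l))
      have h4 : Real.exp (-(s * l)) * Real.exp (s * l) = 1 := by rw [← Real.exp_add]; simp
      nlinarith [Real.exp_pos (s * l)]
    have h5 : p x * l * (Real.exp (s * l) - 1) ≤ e * q x := by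
      rcases le_total l 0 with hl0 | hl0
      · have ha : -(s * l) ≥ 1 - Real.exp (s * l) := by
          linarith [Real.add_one_le_exp (s * l)]
        have hb : p x * l * (Real.exp (s * l) - 1) ≤ s * (p x * l ^ 2) := by
          have := mul_le_mul_of_nonneg_left ha (show 0 ≤ p x * (-l) by nlinarith)
          nlinarith
        have hd : p x * l ^ 2 ≤ 4 * q x := by
          have hlog : l = Real.log (p x / q x) := by
            rw [Real.log_div h.ne' hqx.ne']
          have hr : 0 < p x / q x := by positivity
          have hr1 : p x / q x ≤ 1 := by
            by_contra! hcon
            have := Real.log_pos hcon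
            linarith
          have hA := Real.abs_log_mul_self_rpow_lt (p x / q x) (1 / 2) hr hr1 (by norm_num)
          rw [← hlog] at hA
          have hB : (l * (p x / q x) ^ (1 / 2 : ℝ)) ^ 2 ≤ 4 := by
            rw [← sq_abs]
            have := abs_nonneg (l * (p x / q x) ^ (1 / 2 : ℝ))
            rw [one_div_one_div] at hA
            nlinarith
          rw [mul_pow, ← Real.rpow_natCast ((p x / q x) ^ (1 / 2 : ℝ)), ← Real.rpow_mul hr.le] at hB
          norm_num at hB
          rw [← mul_div_assoc, div_le_iff₀ hqx] at hB
          linarith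
        have : 0 ≤ c * Real.log c * (Real.exp (s * Real.log c) - 1) * q x := by positivity
        rw [he]
        nlinarith
      · have hlle : l ≤ Real.log c := by
          have : Real.log (p x) ≤ Real.log (c * q x) := Real.log_le_log h (hpq x)
          rw [Real.log_mul (by linarith) hqx.ne'] at this
          linarith
        have hE : Real.exp (s * l) - 1 ≤ Real.exp (s * Real.log c) - 1 := by
          gcongr
        have hE0 : 0 ≤ Real.exp (s * l) - 1 := by
          have := Real.one_le_exp (show 0 ≤ s * l by positivity)
          linarith
        calc p x * l * (Real.exp (s * l) - 1)
            ≤ (c * q x) * Real.log c * (Real.exp (s * Real.log c) - 1) := by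
              have := hpq x
              gcongr
          _ ≤ _ := by rw [he]; nlinarith
    nlinarith [mul_le_mul_of_nonneg_left h2 h.le, mul_le_mul_of_nonneg_left h5 hs.le]
  refine (Finset.sum_le_sum fun x _ => key x).trans ?_
  rw [Finset.sum_add_distrib, Finset.sum_add_distrib, ← Finset.mul_sum, ← Finset.mul_sum,
    ← Finset.mul_sum]
  have h6 := Real.add_one_le_exp ((1 + s - 1) * (y + e * (∑ x, q x) / ∑ x, p x))
  have h7 := mul_le_mul_of_nonneg_left h6 hP.le
  have h8 : (∑ x, p x) * ((1 + s - 1) * (y + e * (∑ x, q x) / ∑ x, p x) + 1) =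
      s * ((∑ x, p x) * y) + s * (e * ∑ x, q x) + ∑ x, p x := by
    field_simp; ring
  have h9 := mul_le_mul_of_nonneg_left hy hs.le
  linarith

end Classical

section Trace

set_option linter.unusedSectionVars false

open Matrix

lemma diag_re_nonneg {A : Matrix ι ι ℂ} (hA : A.PosSemidef) (i : ι) : 0 ≤ (A i i).re :=
  (Complex.le_def.1 (hA.diag_nonneg (i := i))).1

lemma norm_entry_sq_le {A : Matrix ι ι ℂ} (hA : A.PosSemidef) (i j : ι) :
    ‖A i j‖ ^ 2 ≤ (A i i).re * (A j j).re := by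
  have h := (hA.submatrix ![i, j]).det_nonneg
  rw [Matrix.det_fin_two] at h
  simp only [submatrix_apply, cons_val_zero, cons_val_one] at h
  have hji : A j i = star (A i j) := (hA.isHermitian.apply j i).symm
  have him : ∀ k, (A k k).im = 0 := fun k =>
    (Complex.le_def.1 (hA.diag_nonneg (i := k))).2.symm
  have h1 := (Complex.le_def.1 h).1
  rw [hji] at h1
  simp only [Complex.zero_re, Complex.sub_re, Complex.mul_re, him, Complex.star_def,
    Complex.conj_re, Complex.conj_im] at h1
  rw [← Complex.normSq_eq_norm_sq, Complex.normSq_apply]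
  linarith

lemma reTrace_eq_sum (A : Matrix ι ι ℂ) : reTrace A = ∑ i, (A i i).re := by
  simp [reTrace, Matrix.trace]

lemma reTrace_nonneg {A : Matrix ι ι ℂ} (hA : A.PosSemidef) : 0 ≤ reTrace A := by
  rw [reTrace_eq_sum]
  exact Finset.sum_nonneg fun i _ => diag_re_nonneg hA i

lemma norm_entry_le_reTrace {A : Matrix ι ι ℂ} (hA : A.PosSemidef) (i j : ι) :
    ‖A i j‖ ≤ reTrace A := by
  have hle : ∀ i, (A i i).re ≤ reTrace A := fun i => by
    rw [reTrace_eq_sum]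
    exact Finset.single_le_sum (f := fun i => (A i i).re) (fun i _ => diag_re_nonneg hA i)
      (Finset.mem_univ i)
  have h := norm_entry_sq_le hA i j
  have h2 := mul_le_mul (hle i) (hle j) (diag_re_nonneg hA j) (reTrace_nonneg hA)
  exact le_of_sq_le_sq (by linarith) (reTrace_nonneg hA)

lemma eq_zero_of_reTrace_eq_zero {A : Matrix ι ι ℂ} (hA : A.PosSemidef) (h : reTrace A = 0) :
    A = 0 := by
  ext i j
  simpa [h] using norm_entry_le_reTrace hA i j

lemma reTrace_pos {A : Matrix ι ι ℂ} (hA : PSDne A) : 0 < reTrace A :=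
  (reTrace_nonneg hA.1).lt_of_ne fun h => hA.2 (eq_zero_of_reTrace_eq_zero hA.1 h.symm)

lemma reTrace_mul_eq_sum (A B : Matrix ι ι ℂ) : reTrace (A * B) = ∑ i, ∑ j, (A i j * B j i).re := by
  rw [reTrace_eq_sum]
  simp only [Matrix.mul_apply, Complex.re_sum]

lemma abs_reTrace_mul_le {M : Matrix ι ι ℂ} (hM : M.PosSemidef) (A : Matrix ι ι ℂ) :
    |reTrace (M * A)| ≤ reTrace M * ∑ i, ∑ j, ‖A i j‖ := by
  rw [reTrace_mul_eq_sum, Finset.sum_comm, Finset.mul_sum]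
  refine (Finset.abs_sum_le_sum_abs _ _).trans (Finset.sum_le_sum fun i _ => ?_)
  rw [Finset.mul_sum]
  refine (Finset.abs_sum_le_sum_abs _ _).trans (Finset.sum_le_sum fun j _ => ?_)
  refine (Complex.abs_re_le_norm _).trans ?_
  rw [norm_mul]
  exact mul_le_mul_of_nonneg_right (norm_entry_le_reTrace hM j i) (norm_nonneg _)

lemma reTrace_sub (A B : Matrix ι ι ℂ) : reTrace (A - B) = reTrace A - reTrace B := by
  simp [reTrace]

lemma continuous_reTrace : Continuous (reTrace : Matrix ι ι ℂ → ℝ) :=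
  Complex.continuous_re.comp continuous_id.matrix_trace

lemma exists_diagonalization {σ : Matrix ι ι ℂ} (hσ : σ.PosSemidef) :
    ∃ (U : Matrix ι ι ℂ) (d : ι → ℝ), U * Uᴴ = 1 ∧ Uᴴ * U = 1 ∧ (∀ i, 0 ≤ d i) ∧
      σ = U * diagonal (fun i => (d i : ℂ)) * Uᴴ ∧
      ∀ g : ℝ → ℝ, hermApply g σ = U * diagonal (fun i => (g (d i) : ℂ)) * Uᴴ := by
  have hH := hσ.isHermitian
  refine ⟨hH.eigenvectorUnitary, hH.eigenvalues, Unitary.coe_mul_star_self _,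
    Unitary.coe_star_mul_self _, fun i => hσ.eigenvalues_nonneg i, ?_, fun g => ?_⟩
  · conv_lhs => rw [hH.spectral_theorem]
    rfl
  · rw [hermApply, dif_pos hH]
    rfl

lemma reTrace_mul_conj_diagonal (M U : Matrix ι ι ℂ) (d : ι → ℝ) :
    reTrace (M * (U * diagonal (fun i => (d i : ℂ)) * Uᴴ)) =
      ∑ i, ((Uᴴ * M * U) i i).re * d i := by
  have : (M * (U * diagonal (fun i => (d i : ℂ)) * Uᴴ)).trace =
      ((Uᴴ * M * U) * diagonal (fun i => (d i : ℂ))).trace := by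
    rw [← mul_assoc, Matrix.trace_mul_comm]
    simp only [mul_assoc]
  rw [reTrace, this, ← reTrace, reTrace_eq_sum]
  simp [Matrix.mul_diagonal]

lemma reTrace_conj {U : Matrix ι ι ℂ} (hU : U * Uᴴ = 1) (M : Matrix ι ι ℂ) :
    reTrace (Uᴴ * M * U) = reTrace M := by
  rw [reTrace, Matrix.trace_mul_comm, ← mul_assoc, hU, one_mul, reTrace]

lemma reTrace_mul_nonneg {M ρ : Matrix ι ι ℂ} (hM : M.PosSemidef) (hρ : ρ.PosSemidef) :
    0 ≤ reTrace (M * ρ) := by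
  obtain ⟨U, d, -, -, hd, hρU, -⟩ := exists_diagonalization hρ
  rw [hρU, reTrace_mul_conj_diagonal]
  exact Finset.sum_nonneg fun i _ =>
    mul_nonneg (diag_re_nonneg (hM.conjTranspose_mul_mul_same U) i) (hd i)

/-- A bound on the function `f` on the spectrum of `σ` passes to expectation values. -/
lemma reTrace_mul_le_rpow {M ρ σ : Matrix ι ι ℂ} {f : ℝ → ℝ} {κ C : ℝ} (hκ : 0 < κ) (hκ1 : κ ≤ 1)
    (hC : 0 ≤ C) (hM : M.PosSemidef) (hM1 : reTrace M = 1) (hσ : σ.PosSemidef)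
    (hρσ : loewnerLE ρ (hermApply f σ)) (hf : ∀ x, 0 ≤ x → x ≤ reTrace σ → f x ≤ C * x ^ κ) :
    reTrace (M * ρ) ≤ C * reTrace (M * σ) ^ κ := by
  obtain ⟨U, d, hU, hU', hd, hσU, hfU⟩ := exists_diagonalization hσ
  have h1 : reTrace (M * ρ) ≤ reTrace (M * hermApply f σ) := by
    have := reTrace_mul_nonneg hM hρσ
    rw [mul_sub, reTrace_sub] at this
    linarith
  have hdσ : ∀ i, d i ≤ reTrace σ := by
    intro i
    have h := reTrace_mul_conj_diagonal 1 U d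
    rw [one_mul, ← hσU, mul_one, hU'] at h
    rw [h]
    simp only [Matrix.one_apply_eq, Complex.one_re, one_mul]
    exact Finset.single_le_sum (fun i _ => hd i) (Finset.mem_univ i)
  have hw := diag_re_nonneg (hM.conjTranspose_mul_mul_same U)
  have hw1 : ∑ i, ((Uᴴ * M * U) i i).re = 1 := by rw [← reTrace_eq_sum, reTrace_conj hU, hM1]
  refine h1.trans ?_
  rw [hfU, reTrace_mul_conj_diagonal]
  conv_rhs => rw [hσU, reTrace_mul_conj_diagonal]
  set w : ι → ℝ := fun i => ((Uᴴ * M * U) i i).re with hwdef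
  have h2 : ∑ i, w i * f (d i) ≤ C * ∑ i, w i * d i ^ κ := by
    rw [Finset.mul_sum]
    refine Finset.sum_le_sum fun i _ => ?_
    have := mul_le_mul_of_nonneg_left (hf (d i) (hd i) (hdσ i)) (hw i)
    linarith
  refine h2.trans (mul_le_mul_of_nonneg_left ?_ hC)
  rcases hκ1.eq_or_lt with rfl | hκ1
  · simp [hwdef]
  · have h := sum_rpow_mul_rpow_le (fun i => w i * d i) w (fun i => mul_nonneg (hw i) (hd i)) hw
      hκ hκ1
    rw [hw1, Real.one_rpow, mul_one] at h
    refine le_trans (Finset.sum_le_sum fun i _ => le_of_eq ?_) h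
    rcases (hw i).eq_or_lt with h0 | h0
    · simp only [hwdef] at h0 ⊢
      rw [← h0, Real.zero_rpow (by linarith : 1 - κ ≠ 0)]
      simp
    · simp only [hwdef] at h0 ⊢
      rw [Real.mul_rpow h0.le (hd i), mul_right_comm, ← Real.rpow_add h0]
      simp

lemma exists_kappa_bound {κ : ℝ} (hκ : 0 < κ) {f : ℝ → ℝ} (hf : IsKappaFunction κ f) (R : ℝ) :
    ∃ C : ℝ, 0 ≤ C ∧ ∀ x, 0 ≤ x → x ≤ R → f x ≤ C * x ^ min κ 1 := by
  obtain ⟨hc, -, M, hM⟩ := hf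
  have hk : 0 < min κ 1 := lt_min hκ one_pos
  have hf0 : f 0 ≤ 0 := by
    have h1 : Tendsto f (𝓝[>] 0) (𝓝 (f 0)) :=
      (hc 0 Set.self_mem_Ici).mono_left (nhdsWithin_mono _ Ioi_subset_Ici_self)
    have h2 : Tendsto (fun x : ℝ => M * x ^ κ) (𝓝[>] 0) (𝓝 (M * 0 ^ κ)) :=
      (((Real.continuous_rpow_const hκ.le).const_mul M).tendsto 0).mono_left nhdsWithin_le_nhds
    rw [Real.zero_rpow hκ.ne', mul_zero] at h2
    exact le_of_tendsto_of_tendsto h1 h2 hM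
  obtain ⟨δ, hδ, hMδ⟩ := mem_nhdsGT_iff_exists_Ioo_subset.1 hM
  replace hδ : 0 < δ := hδ
  set η := min δ 1 with hη
  have hη0 : 0 < η := lt_min hδ one_pos
  obtain ⟨B, hB⟩ := (isCompact_Icc (a := (0 : ℝ)) (b := R)).bddAbove_image
    (hc.mono Icc_subset_Ici_self)
  refine ⟨|M| + |B| / η ^ min κ 1, by positivity, fun x hx hxR => ?_⟩
  rcases hx.eq_or_lt with rfl | hx
  · rw [Real.zero_rpow hk.ne', mul_zero]; exact hf0
  have hxk : 0 < x ^ min κ 1 := by positivity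
  have hηk : 0 < η ^ min κ 1 := by positivity
  rw [add_mul]
  rcases lt_or_ge x η with hxη | hxη
  · have h1 : f x ≤ M * x ^ κ := hMδ ⟨hx, hxη.trans_le (min_le_left _ _)⟩
    have h2 : x ^ κ ≤ x ^ min κ 1 :=
      Real.rpow_le_rpow_of_exponent_ge hx (hxη.le.trans (min_le_right _ _)) (min_le_left _ _)
    have h3 : M * x ^ κ ≤ |M| * x ^ min κ 1 :=
      mul_le_mul (le_abs_self M) h2 (by positivity) (abs_nonneg M)
    have h4 : 0 ≤ |B| / η ^ min κ 1 * x ^ min κ 1 := by positivity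
    linarith
  · have h1 : f x ≤ |B| := (hB ⟨x, ⟨hx.le, hxR⟩, rfl⟩).trans (le_abs_self B)
    have h2 : |B| ≤ |B| / η ^ min κ 1 * x ^ min κ 1 := by
      rw [div_mul_eq_mul_div, le_div_iff₀ hηk]
      gcongr
    have h3 : 0 ≤ |M| * x ^ min κ 1 := by positivity
    linarith

/-- A pinching inequality for trace products of positive semidefinite matrices. -/
lemma reTrace_mul_le_card_mul_sum_diag {M ρ : Matrix ι ι ℂ} (hM : M.PosSemidef)
    (hρ : ρ.PosSemidef) :
    reTrace (M * ρ) ≤ Fintype.card ι * ∑ i, (M i i).re * (ρ i i).re := by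
  have key : ∀ i j, (M i j * ρ j i).re ≤
      ((M i i).re * (ρ i i).re + (M j j).re * (ρ j j).re) / 2 := by
    intro i j
    have h1 := norm_entry_sq_le hM i j
    have h2 := norm_entry_sq_le hρ j i
    have hMi := diag_re_nonneg hM i
    have hMj := diag_re_nonneg hM j
    have hρi := diag_re_nonneg hρ i
    have hρj := diag_re_nonneg hρ j
    refine (Complex.re_le_norm _).trans ?_
    refine le_of_sq_le_sq ?_ (by positivity)
    rw [norm_mul, mul_pow]
    have h3 := mul_le_mul h1 h2 (by positivity) (by positivity)
    nlinarith [sq_nonneg ((M i i).re * (ρ i i).re - (M j j).re * (ρ j j).re)]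
  rw [reTrace_mul_eq_sum]
  refine (Finset.sum_le_sum fun i _ => Finset.sum_le_sum fun j _ => key i j).trans (le_of_eq ?_)
  simp only [add_div, Finset.sum_add_distrib, Finset.sum_const, Finset.card_univ, nsmul_eq_mul,
    ← Finset.mul_sum, ← Finset.sum_div]
  ring

end Trace

section Measurement

set_option linter.unusedSectionVars false

open Matrix

variable (ι) in
/-- A positive operator-valued measure with finitely many outcomes. -/
structure POVM where
  /-- the number of outcomes -/
  card : ℕ
  /-- the effect operators -/
  effect : Fin card → Matrix ι ι ℂ
  posSemidef : ∀ i, (effect i).PosSemidef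
  sum_effect : ∑ i, effect i = 1

/-- The outcome weights of a measurement. -/
def POVM.prob (j : POVM ι) (ρ : Matrix ι ι ℂ) : Fin j.card → ℝ :=
  fun i => reTrace (j.effect i * ρ)

lemma Dmeas_eq_iSup (α : ℝ) (ρ σ : Matrix ι ι ℂ) :
    Dmeas α ρ σ = ⨆ j : POVM ι, Dcl α (j.prob ρ) (j.prob σ) := by
  refine le_antisymm ?_ ?_
  · exact iSup_le fun k => iSup_le fun M => iSup_le fun h =>
      le_iSup (fun j : POVM ι => Dcl α (j.prob ρ) (j.prob σ)) ⟨k, M, h.1, h.2⟩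
  · exact iSup_le fun j => le_iSup_of_le j.card (le_iSup_of_le j.effect
      (le_iSup_of_le ⟨j.posSemidef, j.sum_effect⟩ le_rfl))

lemma Dmeas_le_iff {α : ℝ} {ρ σ : Matrix ι ι ℂ} {y : EReal} :
    Dmeas α ρ σ ≤ y ↔ ∀ j : POVM ι, Dcl α (j.prob ρ) (j.prob σ) ≤ y := by
  rw [Dmeas_eq_iSup, iSup_le_iff]

lemma Dcl_le_Dmeas (α : ℝ) (ρ σ : Matrix ι ι ℂ) (j : POVM ι) :
    Dcl α (j.prob ρ) (j.prob σ) ≤ Dmeas α ρ σ :=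
  Dmeas_le_iff.1 le_rfl j

lemma POVM.prob_nonneg (j : POVM ι) {ρ : Matrix ι ι ℂ} (hρ : ρ.PosSemidef) (i : Fin j.card) :
    0 ≤ j.prob ρ i :=
  reTrace_mul_nonneg (j.posSemidef i) hρ

lemma POVM.sum_prob (j : POVM ι) (ρ : Matrix ι ι ℂ) : ∑ i, j.prob ρ i = reTrace ρ := by
  have h : reTrace ((∑ i, j.effect i) * ρ) = ∑ i, j.prob ρ i := by
    simp [reTrace, POVM.prob, Finset.sum_mul, Matrix.trace_sum]
  rw [← h, j.sum_effect, one_mul]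

lemma POVM.sum_prob_pos (j : POVM ι) {ρ : Matrix ι ι ℂ} (hρ : PSDne ρ) :
    0 < ∑ i, j.prob ρ i := by
  rw [j.sum_prob]; exact reTrace_pos hρ

instance : Nonempty (POVM ι) :=
  ⟨⟨1, fun _ => 1, fun _ => Matrix.PosSemidef.one, by simp⟩⟩

lemma Dmeas_ne_bot (α : ℝ) (ρ σ : Matrix ι ι ℂ) : Dmeas α ρ σ ≠ ⊥ := by
  obtain ⟨j⟩ := (inferInstance : Nonempty (POVM ι))
  exact fun h => Dcl_ne_bot α (le_bot_iff.1 ((Dcl_le_Dmeas α ρ σ j).trans h.le))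

lemma Dmeas_mono {ρ σ : Matrix ι ι ℂ} (hρ : PSDne ρ) (hσ : PSDne σ) {a b : ℝ} (ha : 0 < a)
    (hab : a ≤ b) : Dmeas a ρ σ ≤ Dmeas b ρ σ :=
  Dmeas_le_iff.2 fun j => (Dcl_mono (j.prob_nonneg hρ.1) (j.prob_nonneg hσ.1)
    (j.sum_prob_pos hρ) ha hab).trans (Dcl_le_Dmeas b ρ σ j)

/-- The measurement in the eigenbasis of `σ` detects whether `ρ ≤ c σ` for some `c`. -/
lemma exists_dominating_const {ρ σ : Matrix ι ι ℂ} (hρ : ρ.PosSemidef) (hσ : σ.PosSemidef)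
    (hac : ∀ j : POVM ι, acl (j.prob ρ) (j.prob σ)) :
    ∃ c : ℝ, 1 ≤ c ∧ ∀ M : Matrix ι ι ℂ, M.PosSemidef → reTrace (M * ρ) ≤ c * reTrace (M * σ) := by
  obtain ⟨U, d, hU, hU', hd, hσU, -⟩ := exists_diagonalization hσ
  let e := (Fintype.equivFin ι).symm
  let E : ι → Matrix ι ι ℂ := fun i => U * diagonal (Pi.single i 1) * Uᴴ
  have hE : ∀ i, (E i).PosSemidef := fun i => by
    refine Matrix.PosSemidef.mul_mul_conjTranspose_same ?_ U
    refine Matrix.PosSemidef.diagonal fun k => ?_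
    by_cases hk : k = i
    · subst hk; simp
    · simp [hk]
  have hsum : ∑ i, E i = 1 := by
    have : ∑ i, diagonal (Pi.single i (1 : ℂ)) = (1 : Matrix ι ι ℂ) := by
      ext a b
      rw [Matrix.sum_apply]
      by_cases hab : a = b
      · subst hab
        simp [Pi.single_apply]
      · simp [hab]
    simp only [E]
    rw [← Finset.sum_mul, ← Finset.mul_sum, this, mul_one, hU]
  let j : POVM ι := ⟨Fintype.card ι, fun k => E (e k), fun k => hE _, by
    rw [Equiv.sum_comp e E, hsum]⟩
  have hEA : ∀ (A : Matrix ι ι ℂ) i, reTrace (E i * A) = ((Uᴴ * A * U) i i).re := by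
    intro A i
    have : (E i * A).trace = (diagonal (Pi.single i (1 : ℂ)) * (Uᴴ * A * U)).trace := by
      simp only [E]
      rw [mul_assoc, mul_assoc, Matrix.trace_mul_comm]
      simp only [mul_assoc]
    rw [reTrace, this, ← reTrace, reTrace_eq_sum]
    simp only [Matrix.diagonal_mul]
    rw [Finset.sum_eq_single i]
    · simp
    · intro b _ hb; simp [hb]
    · simp
  have hdiag : ∀ i, ((Uᴴ * σ * U) i i).re = d i := by
    intro i
    have : Uᴴ * σ * U = diagonal (fun i => (d i : ℂ)) := by
      rw [hσU]
      calc _ = (Uᴴ * U) * diagonal (fun i => (d i : ℂ)) * (Uᴴ * U) := by simp only [mul_assoc]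
        _ = _ := by rw [hU', one_mul, mul_one]
    rw [this]; simp
  set r : ι → ℝ := fun i => ((Uᴴ * ρ * U) i i).re with hr
  have hρ' := hρ.conjTranspose_mul_mul_same U
  have hr0 : ∀ i, 0 ≤ r i := diag_re_nonneg hρ'
  have hzero : ∀ i, d i = 0 → r i = 0 := by
    intro i hi
    have h := hac j (e.symm i)
    simp only [j, POVM.prob, Equiv.apply_symm_apply, hEA, hdiag] at h
    exact h hi
  set c₀ : ℝ := ∑ i, r i / d i with hc₀
  have hc₀0 : 0 ≤ c₀ := Finset.sum_nonneg fun i _ => div_nonneg (hr0 i) (hd i)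
  have hrd : ∀ i, r i ≤ c₀ * d i := by
    intro i
    rcases (hd i).eq_or_lt with h | h
    · rw [hzero i h.symm, ← h, mul_zero]
    · rw [← div_le_iff₀ h]
      exact Finset.single_le_sum (f := fun i => r i / d i)
        (fun i _ => div_nonneg (hr0 i) (hd i)) (Finset.mem_univ i)
  refine ⟨Fintype.card ι * c₀ + 1, by simp only [le_add_iff_nonneg_left]; positivity,
    fun M hM => ?_⟩
  have hM' := hM.conjTranspose_mul_mul_same U
  have hMσ : reTrace (M * σ) = ∑ i, ((Uᴴ * M * U) i i).re * d i := by
    conv_lhs => rw [hσU]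
    exact reTrace_mul_conj_diagonal M U d
  have hMρ : reTrace (M * ρ) = reTrace ((Uᴴ * M * U) * (Uᴴ * ρ * U)) := by
    have : (Uᴴ * M * U) * (Uᴴ * ρ * U) = Uᴴ * (M * ρ) * U := by
      calc _ = Uᴴ * M * (U * Uᴴ) * ρ * U := by simp only [mul_assoc]
        _ = _ := by rw [hU, mul_one]; simp only [mul_assoc]
    rw [this, reTrace_conj hU]
  have h1 := reTrace_mul_le_card_mul_sum_diag hM' hρ'
  have h2 : ∑ i, ((Uᴴ * M * U) i i).re * r i ≤ c₀ * reTrace (M * σ) := by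
    rw [hMσ, Finset.mul_sum]
    refine Finset.sum_le_sum fun i _ => ?_
    have := mul_le_mul_of_nonneg_left (hrd i) (diag_re_nonneg hM' i)
    linarith
  have h3 := mul_le_mul_of_nonneg_left h2 (Nat.cast_nonneg (α := ℝ) (Fintype.card ι))
  have h4 := reTrace_mul_nonneg hM hσ
  rw [hMρ]
  linarith

end Measurement

section Continuity

set_option linter.unusedSectionVars false

lemma continuousWithinAt_of_le_iff {T J : Type*} [TopologicalSpace T] {S : Set T} {t : T}
    (ht : t ∈ S) {D : T → EReal} {H : J → T → ℝ} {h : ℝ → T → ℝ}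
    (hD : ∀ᶠ s in 𝓝[S] t, ∀ y : ℝ, D s ≤ (y : EReal) ↔ ∀ j, H j s ≤ h y s)
    (hmono : StrictMono fun y => h y t) (hcont : ∀ y, ContinuousWithinAt (h y) S t)
    (hH : ∀ ε > 0, ∀ᶠ s in 𝓝[S] t, ∀ j, |H j s - H j t| < ε) :
    ContinuousWithinAt D S t := by
  have hDt := hD.self_of_nhdsWithin ht
  refine tendsto_order.2 ⟨fun y' hy' => ?_, fun y' hy' => ?_⟩
  · obtain ⟨y₀, h₀, h₀'⟩ := EReal.lt_iff_exists_real_btwn.1 hy'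
    obtain ⟨y₁, h₁, h₁'⟩ := EReal.lt_iff_exists_real_btwn.1 h₀'
    have hlt : h y₀ t < h y₁ t := hmono (EReal.coe_lt_coe_iff.1 h₁)
    have hn := mt (hDt y₁).2 (not_le.2 h₁')
    push Not at hn
    obtain ⟨j, hj⟩ := hn
    have hε : 0 < (h y₁ t - h y₀ t) / 2 := by linarith
    have hc : ∀ᶠ s in 𝓝[S] t, h y₀ s < h y₀ t + (h y₁ t - h y₀ t) / 2 :=
      (hcont y₀).eventually (gt_mem_nhds (by linarith))
    filter_upwards [hD, hc, hH _ hε] with s hs hcs hHs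
    refine h₀.trans (not_le.1 fun hle => ?_)
    have h1 := (hs y₀).1 hle j
    have h2 := (abs_lt.1 (hHs j)).1
    linarith
  · obtain ⟨y₁, h₁, h₁'⟩ := EReal.lt_iff_exists_real_btwn.1 hy'
    obtain ⟨y₀, h₀, h₀'⟩ := EReal.lt_iff_exists_real_btwn.1 h₁
    have hlt : h y₀ t < h y₁ t := hmono (EReal.coe_lt_coe_iff.1 h₀')
    have hj := (hDt y₀).1 h₀.le
    have hε : 0 < (h y₁ t - h y₀ t) / 2 := by linarith
    have hc : ∀ᶠ s in 𝓝[S] t, h y₁ t - (h y₁ t - h y₀ t) / 2 < h y₁ s :=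
      (hcont y₁).eventually (lt_mem_nhds (by linarith))
    filter_upwards [hD, hc, hH _ hε] with s hs hcs hHs
    refine lt_of_le_of_lt ((hs y₁).2 fun j => ?_) h₁'
    have h1 := hj j
    have h2 := (abs_lt.1 (hHs j)).2
    linarith

lemma reTrace_smul (c : ℝ) (A : Matrix ι ι ℂ) : reTrace (c • A) = c * reTrace A := by
  simp [reTrace, Matrix.trace_smul]

/-- Weighted sums of a continuous, positively homogeneous function of the outcome weights are
equicontinuous over all measurements. -/
lemma equicontinuous_sum_prob {φ : ℝ × ℝ × ℝ → ℝ} {K : Set (ℝ × ℝ × ℝ)} (hK : IsCompact K)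
    (hφ : ContinuousOn φ K) (hφ0 : ∀ α, φ (α, 0, 0) = 0)
    (hom : ∀ m α a b : ℝ, 0 < m → (α, a, b) ∈ K → φ (α, m * a, m * b) = m * φ (α, a, b))
    {S : Set (ℝ × Matrix ι ι ℂ × Matrix ι ι ℂ)} {t : ℝ × Matrix ι ι ℂ × Matrix ι ι ℂ} (ht : t ∈ S)
    (hmem : ∀ᶠ s in 𝓝[S] t, ∀ M : Matrix ι ι ℂ, M.PosSemidef → reTrace M = 1 →
      (s.1, reTrace (M * s.2.1), reTrace (M * s.2.2)) ∈ K) {ε : ℝ} (hε : 0 < ε) :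
    ∀ᶠ s in 𝓝[S] t, ∀ j : POVM ι,
      |∑ i, φ (s.1, j.prob s.2.1 i, j.prob s.2.2 i) -
        ∑ i, φ (t.1, j.prob t.2.1 i, j.prob t.2.2 i)| < ε := by
  set N : ℝ := (Fintype.card ι : ℝ) with hN
  have hN0 : 0 ≤ N := Nat.cast_nonneg _
  have hε' : 0 < ε / (N + 1) := by positivity
  obtain ⟨δ, hδ, hu⟩ := Metric.uniformContinuousOn_iff.1
    (hK.uniformContinuousOn_of_continuous hφ) _ hε'
  have hmemt := hmem.self_of_nhdsWithin ht
  have h1 : ∀ᶠ s in 𝓝[S] t, dist s.1 t.1 < δ :=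
    nhdsWithin_le_nhds (continuous_fst.continuousAt.eventually (Metric.ball_mem_nhds _ hδ))
  have h2 : ∀ᶠ s in 𝓝[S] t, ∑ a, ∑ b, ‖(s.2.1 - t.2.1) a b‖ < δ := by
    have hc : Continuous fun s : ℝ × Matrix ι ι ℂ × Matrix ι ι ℂ =>
        ∑ a, ∑ b, ‖(s.2.1 - t.2.1) a b‖ := by
      refine continuous_finsetSum _ fun a _ => continuous_finsetSum _ fun b _ => ?_
      exact ((continuous_snd.fst.sub continuous_const).matrix_elem a b).norm
    exact nhdsWithin_le_nhds (hc.continuousAt.eventually (gt_mem_nhds (by simpa using hδ)))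
  have h3 : ∀ᶠ s in 𝓝[S] t, ∑ a, ∑ b, ‖(s.2.2 - t.2.2) a b‖ < δ := by
    have hc : Continuous fun s : ℝ × Matrix ι ι ℂ × Matrix ι ι ℂ =>
        ∑ a, ∑ b, ‖(s.2.2 - t.2.2) a b‖ := by
      refine continuous_finsetSum _ fun a _ => continuous_finsetSum _ fun b _ => ?_
      exact ((continuous_snd.snd.sub continuous_const).matrix_elem a b).norm
    exact nhdsWithin_le_nhds (hc.continuousAt.eventually (gt_mem_nhds (by simpa using hδ)))
  filter_upwards [hmem, h1, h2, h3] with s hs hs1 hs2 hs3 j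
  have hdist : ∀ {M A B : Matrix ι ι ℂ}, M.PosSemidef → reTrace M = 1 →
      ∑ a, ∑ b, ‖(A - B) a b‖ < δ → dist (reTrace (M * A)) (reTrace (M * B)) < δ := by
    intro M A B hM hM1 hAB
    rw [Real.dist_eq, ← reTrace_sub, ← mul_sub]
    refine (abs_reTrace_mul_le hM _).trans_lt ?_
    rwa [hM1, one_mul]
  have key : ∀ i, |φ (s.1, j.prob s.2.1 i, j.prob s.2.2 i) -
      φ (t.1, j.prob t.2.1 i, j.prob t.2.2 i)| ≤ ε / (N + 1) * reTrace (j.effect i) := by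
    intro i
    have hM := j.posSemidef i
    rcases (reTrace_nonneg hM).eq_or_lt with h0 | h0
    · have hz : ∀ A, j.prob A i = 0 := fun A => by
        rw [POVM.prob, eq_zero_of_reTrace_eq_zero hM h0.symm, zero_mul]
        simp [reTrace]
      simp [hz, hφ0, ← h0]
    · set m := reTrace (j.effect i) with hm
      have hM' : (m⁻¹ • j.effect i).PosSemidef := hM.smul (inv_nonneg.2 h0.le)
      have hM1 : reTrace (m⁻¹ • j.effect i) = 1 := by
        rw [reTrace_smul]; exact inv_mul_cancel₀ h0.ne'
      have hpr : ∀ A, j.prob A i = m * reTrace (m⁻¹ • j.effect i * A) := fun A => by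
        rw [Matrix.smul_mul, reTrace_smul, POVM.prob, mul_inv_cancel_left₀ h0.ne']
      have hKs := hs _ hM' hM1
      have hKt := hmemt _ hM' hM1
      simp only [hpr]
      rw [hom _ _ _ _ h0 hKs, hom _ _ _ _ h0 hKt, ← mul_sub, abs_mul, abs_of_pos h0, mul_comm]
      refine mul_le_mul_of_nonneg_right ?_ h0.le
      refine (hu _ hKs _ hKt ?_).le
      simp only [Prod.dist_eq, max_lt_iff]
      exact ⟨hs1, hdist hM' hM1 hs2, hdist hM' hM1 hs3⟩
  have hsum : ∑ i, reTrace (j.effect i) = N := by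
    have h := j.sum_prob 1
    simp only [POVM.prob, mul_one] at h
    rw [h]; simp [reTrace, hN]
  rw [← Finset.sum_sub_distrib]
  refine ((Finset.abs_sum_le_sum_abs _ _).trans (Finset.sum_le_sum fun i _ => key i)).trans_lt ?_
  rw [← Finset.mul_sum, hsum, div_mul_eq_mul_div, div_lt_iff₀ (by positivity)]
  nlinarith

lemma rpow_mul_rpow_homogeneous {m a b : ℝ} (α : ℝ) (hm : 0 < m) (ha : 0 ≤ a) (hb : 0 ≤ b) :
    (m * a) ^ α * (m * b) ^ (1 - α) = m * (a ^ α * b ^ (1 - α)) := by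
  rw [Real.mul_rpow hm.le ha, Real.mul_rpow hm.le hb, mul_mul_mul_comm, ← Real.rpow_add hm]
  simp

lemma zero_rpow_mul_zero_rpow (α : ℝ) : (0 : ℝ) ^ α * 0 ^ (1 - α) = 0 := by
  by_cases h : α = 0
  · simp [h]
  · rw [Real.zero_rpow h, zero_mul]

/-- The compact parameter region on which the outcome weights satisfy `a ≤ C b ^ κ`. -/
def kappaRegion (α₀ α₁ R C κ : ℝ) : Set (ℝ × ℝ × ℝ) :=
  {x | x.1 ∈ Icc α₀ α₁ ∧ x.2.2 ∈ Icc 0 R ∧ 0 ≤ x.2.1 ∧ x.2.1 ≤ C * x.2.2 ^ κ}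

lemma isCompact_kappaRegion {α₀ α₁ R C κ : ℝ} (hC : 0 ≤ C) (hκ : 0 ≤ κ) :
    IsCompact (kappaRegion α₀ α₁ R C κ) := by
  refine IsCompact.of_isClosed_subset ((isCompact_Icc (a := α₀) (b := α₁)).prod
    ((isCompact_Icc (a := (0 : ℝ)) (b := C * R ^ κ)).prod (isCompact_Icc (a := (0 : ℝ)) (b := R))))
    ?_ ?_
  · have h1 : IsClosed {x : ℝ × ℝ × ℝ | x.1 ∈ Icc α₀ α₁} := isClosed_Icc.preimage continuous_fst
    have h2 : IsClosed {x : ℝ × ℝ × ℝ | x.2.2 ∈ Icc 0 R} :=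
      isClosed_Icc.preimage continuous_snd.snd
    have h3 : IsClosed {x : ℝ × ℝ × ℝ | 0 ≤ x.2.1} :=
      isClosed_le continuous_const continuous_snd.fst
    have h4 : IsClosed {x : ℝ × ℝ × ℝ | x.2.1 ≤ C * x.2.2 ^ κ} :=
      isClosed_le continuous_snd.fst
        (((Real.continuous_rpow_const hκ).comp continuous_snd.snd).const_mul C)
    exact h1.inter (h2.inter (h3.inter h4))
  · rintro ⟨α, a, b⟩ ⟨h1, h2, h3, h4⟩
    refine ⟨h1, ⟨h3, h4.trans ?_⟩, h2⟩
    exact mul_le_mul_of_nonneg_left (Real.rpow_le_rpow h2.1 h2.2 hκ) hC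

lemma eq_zero_of_mem_kappaRegion {α₀ α₁ R C κ : ℝ} (hκ : 0 < κ) {x : ℝ × ℝ × ℝ}
    (hx : x ∈ kappaRegion α₀ α₁ R C κ) (hb : x.2.2 = 0) : x.2.1 = 0 := by
  have h := hx.2.2.2
  rw [hb, Real.zero_rpow hκ.ne', mul_zero] at h
  exact le_antisymm h hx.2.2.1

lemma continuousOn_rpow_mul_rpow_kappaRegion {α₀ α₁ R C κ : ℝ} (hα₀ : 0 < α₀) (hκ : 0 < κ)
    (hC : 0 < C) (hα₁ : ∀ α, α₀ ≤ α → α ≤ α₁ → (1 - κ) * α < 1) :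
    ContinuousOn (fun x : ℝ × ℝ × ℝ => x.2.1 ^ x.1 * x.2.2 ^ (1 - x.1))
      (kappaRegion α₀ α₁ R C κ) := by
  intro x hx
  have hx0 : 0 < x.1 := hα₀.trans_le hx.1.1
  have c1 : ContinuousAt (fun x : ℝ × ℝ × ℝ => x.1) x := continuous_fst.continuousAt
  have c2 : ContinuousAt (fun x : ℝ × ℝ × ℝ => x.2.1) x := continuous_snd.fst.continuousAt
  have c3 : ContinuousAt (fun x : ℝ × ℝ × ℝ => x.2.2) x := continuous_snd.snd.continuousAt
  rcases hx.2.1.1.eq_or_lt with hb | hb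
  swap
  · exact ((c2.rpow c1 (Or.inr hx0)).mul
      (c3.rpow (continuousAt_const.sub c1) (Or.inl hb.ne'))).continuousWithinAt
  have ha := eq_zero_of_mem_kappaRegion hκ hx hb.symm
  have hexp : 0 < κ * x.1 + (1 - x.1) := by linarith [hα₁ x.1 hx.1.1 hx.1.2]
  have cB : ContinuousAt (fun x : ℝ × ℝ × ℝ => C ^ x.1 * x.2.2 ^ (κ * x.1 + (1 - x.1))) x :=
    (continuousAt_const.rpow c1 (Or.inl hC.ne')).mul
      (c3.rpow ((continuousAt_const.mul c1).add (continuousAt_const.sub c1)) (Or.inr hexp))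
  have hB0 : C ^ x.1 * x.2.2 ^ (κ * x.1 + (1 - x.1)) = 0 := by
    rw [← hb, Real.zero_rpow hexp.ne', mul_zero]
  have hv : x.2.1 ^ x.1 * x.2.2 ^ (1 - x.1) = 0 := by rw [ha, Real.zero_rpow hx0.ne', zero_mul]
  unfold ContinuousWithinAt
  beta_reduce
  rw [hv]
  refine tendsto_of_tendsto_of_tendsto_of_le_of_le' tendsto_const_nhds
    (hB0 ▸ cB.continuousWithinAt.tendsto) ?_ ?_
  · filter_upwards [self_mem_nhdsWithin] with z hz
    exact mul_nonneg (Real.rpow_nonneg hz.2.2.1 _) (Real.rpow_nonneg hz.2.1.1 _)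
  · filter_upwards [self_mem_nhdsWithin] with z hz
    have hz0 : 0 < z.1 := hα₀.trans_le hz.1.1
    rcases hz.2.1.1.eq_or_lt with hb | hb
    · rw [eq_zero_of_mem_kappaRegion hκ hz hb.symm, Real.zero_rpow hz0.ne', zero_mul]
      exact mul_nonneg (Real.rpow_nonneg hC.le _) (Real.rpow_nonneg hz.2.1.1 _)
    · rw [Real.rpow_add hb, ← mul_assoc]
      refine mul_le_mul_of_nonneg_right ?_ (by positivity)
      rw [Real.rpow_mul hb.le, ← Real.mul_rpow hC.le (by positivity)]
      exact Real.rpow_le_rpow hz.2.2.1 hz.2.2.2 hz0.le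

lemma continuousOn_relEntropy_kappaRegion {α₀ α₁ R C κ : ℝ} (hκ : 0 < κ) (hC : 0 < C) :
    ContinuousOn (fun x : ℝ × ℝ × ℝ => x.2.1 * (Real.log x.2.1 - Real.log x.2.2))
      (kappaRegion α₀ α₁ R C κ) := by
  intro x hx
  have c2 : ContinuousAt (fun x : ℝ × ℝ × ℝ => x.2.1) x := continuous_snd.fst.continuousAt
  have c3 : ContinuousAt (fun x : ℝ × ℝ × ℝ => x.2.2) x := continuous_snd.snd.continuousAt
  have c4 : ContinuousAt (fun x : ℝ × ℝ × ℝ => x.2.1 * Real.log x.2.1) x :=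
    (Real.continuous_mul_log.comp continuous_snd.fst).continuousAt
  simp only [mul_sub]
  refine c4.continuousWithinAt.sub ?_
  rcases hx.2.1.1.eq_or_lt with hb | hb
  swap
  · exact (c2.mul (c3.log hb.ne')).continuousWithinAt
  have ha := eq_zero_of_mem_kappaRegion hκ hx hb.symm
  have hκ2 : 0 < κ / 2 := by linarith
  have cB : ContinuousAt (fun x : ℝ × ℝ × ℝ => C * (1 / (κ / 2)) * x.2.2 ^ (κ / 2)) x :=
    continuousAt_const.mul (c3.rpow continuousAt_const (Or.inr hκ2))
  have hB0 : C * (1 / (κ / 2)) * x.2.2 ^ (κ / 2) = 0 := by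
    rw [← hb, Real.zero_rpow hκ2.ne', mul_zero]
  have hv : x.2.1 * Real.log x.2.2 = 0 := by rw [ha, zero_mul]
  unfold ContinuousWithinAt
  beta_reduce
  rw [hv]
  refine squeeze_zero_norm' ?_ (hB0 ▸ cB.continuousWithinAt.tendsto)
  have hlt : ∀ᶠ z in 𝓝[kappaRegion α₀ α₁ R C κ] x, z.2.2 < 1 :=
    nhdsWithin_le_nhds (c3.eventually (gt_mem_nhds (by beta_reduce; rw [← hb]; exact one_pos)))
  filter_upwards [self_mem_nhdsWithin, hlt] with z hz hz1
  rcases hz.2.1.1.eq_or_lt with hb | hb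
  · rw [eq_zero_of_mem_kappaRegion hκ hz hb.symm, zero_mul, norm_zero]
    exact mul_nonneg (by positivity) (Real.rpow_nonneg hz.2.1.1 _)
  · have h := Real.abs_log_mul_self_rpow_lt z.2.2 (κ / 2) hb hz1.le hκ2
    rw [abs_mul, abs_of_nonneg (Real.rpow_nonneg hb.le (κ / 2))] at h
    rw [Real.norm_eq_abs, abs_mul, abs_of_nonneg hz.2.2.1]
    have hsplit : z.2.2 ^ κ = z.2.2 ^ (κ / 2) * z.2.2 ^ (κ / 2) := by
      rw [← Real.rpow_add hb, add_halves]
    calc z.2.1 * |Real.log z.2.2| ≤ C * z.2.2 ^ κ * |Real.log z.2.2| :=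
          mul_le_mul_of_nonneg_right hz.2.2.2 (abs_nonneg _)
      _ = C * (|Real.log z.2.2| * z.2.2 ^ (κ / 2)) * z.2.2 ^ (κ / 2) := by rw [hsplit]; ring
      _ ≤ C * (1 / (κ / 2)) * z.2.2 ^ (κ / 2) := by gcongr

end Continuity

section MeasuredContinuity

set_option linter.unusedSectionVars false

lemma eventually_reTrace_le {S : Set (ℝ × Matrix ι ι ℂ × Matrix ι ι ℂ)}
    (t : ℝ × Matrix ι ι ℂ × Matrix ι ι ℂ) :
    ∀ᶠ s in 𝓝[S] t, reTrace s.2.2 ≤ reTrace t.2.2 + 1 := by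
  have hc : Continuous fun s : ℝ × Matrix ι ι ℂ × Matrix ι ι ℂ => reTrace s.2.2 :=
    continuous_reTrace.comp continuous_snd.snd
  filter_upwards [nhdsWithin_le_nhds (s := S) (hc.continuousAt.eventually
    (gt_mem_nhds (lt_add_one (reTrace t.2.2))))] with s hs using le_of_lt hs

lemma continuousWithinAt_Dmeas_of_lt_one {S : Set (ℝ × Matrix ι ι ℂ × Matrix ι ι ℂ)}
    {t : ℝ × Matrix ι ι ℂ × Matrix ι ι ℂ} (ht : t ∈ S)
    (hS : ∀ s ∈ S, s.1 ∈ Ioo (0 : ℝ) 1 ∧ PSDne s.2.1 ∧ PSDne s.2.2) :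
    ContinuousWithinAt (fun s => Dmeas s.1 s.2.1 s.2.2) S t := by
  obtain ⟨⟨ht0, ht1⟩, -, -⟩ := hS t ht
  refine continuousWithinAt_of_le_iff (J := POVM ι) ht
    (H := fun j s => -Qcl s.1 (j.prob s.2.1) (j.prob s.2.2))
    (h := fun y s => -(reTrace s.2.1 * Real.exp ((s.1 - 1) * y))) ?_ ?_ ?_ ?_
  · filter_upwards [self_mem_nhdsWithin] with s hs y
    obtain ⟨hs1, hρ, hσ⟩ := hS s hs
    rw [Dmeas_le_iff]
    refine forall_congr' fun j => ?_
    rw [Dcl_le_iff_of_lt_one (j.prob_nonneg hρ.1) (j.prob_nonneg hσ.1) (j.sum_prob_pos hρ) hs1.2,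
      j.sum_prob, neg_le_neg_iff]
  · intro y₁ y₂ hy
    have hP := reTrace_pos (hS t ht).2.1
    refine neg_lt_neg (mul_lt_mul_of_pos_left (Real.exp_lt_exp.2 ?_) hP)
    exact mul_lt_mul_of_neg_left hy (by linarith)
  · intro y
    refine Continuous.continuousWithinAt ?_
    exact ((continuous_reTrace.comp continuous_snd.fst).mul (Real.continuous_exp.comp
      ((continuous_fst.sub continuous_const).mul continuous_const))).neg
  · intro ε hε
    set N : Matrix ι ι ℂ → ℝ := fun A => ∑ a, ∑ b, ‖A a b‖ with hN
    have hNc : Continuous N := continuous_finsetSum _ fun a _ => continuous_finsetSum _ fun b _ =>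
      (continuous_id.matrix_elem a b).norm
    set R : ℝ := max (N t.2.1) (N t.2.2) + 1 with hR
    have e1 : ∀ᶠ s in 𝓝[S] t, N s.2.1 < R :=
      nhdsWithin_le_nhds ((hNc.comp continuous_snd.fst).continuousAt.eventually
        (gt_mem_nhds (lt_of_le_of_lt (le_max_left _ (N t.2.2)) (lt_add_one _))))
    have e2 : ∀ᶠ s in 𝓝[S] t, N s.2.2 < R :=
      nhdsWithin_le_nhds ((hNc.comp continuous_snd.snd).continuousAt.eventually
        (gt_mem_nhds (lt_of_le_of_lt (le_max_right (N t.2.1) _) (lt_add_one _))))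
    have e3 : ∀ᶠ s in 𝓝[S] t, s.1 ∈ Icc (t.1 / 2) ((1 + t.1) / 2) :=
      nhdsWithin_le_nhds (continuous_fst.continuousAt.eventually
        (Icc_mem_nhds (by linarith) (by linarith)))
    have := equicontinuous_sum_prob (ι := ι) (φ := fun x => x.2.1 ^ x.1 * x.2.2 ^ (1 - x.1))
      (K := Icc (t.1 / 2) ((1 + t.1) / 2) ×ˢ (Icc 0 R ×ˢ Icc 0 R))
      (isCompact_Icc.prod (isCompact_Icc.prod isCompact_Icc)) ?_ zero_rpow_mul_zero_rpow ?_ ht ?_ hε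
    · filter_upwards [this] with s hs j
      rw [neg_sub_neg, abs_sub_comm]
      exact hs j
    · intro x hx
      have hx0 : 0 < x.1 := lt_of_lt_of_le (by linarith) hx.1.1
      have hx1 : 0 < 1 - x.1 := by linarith [hx.1.2]
      exact ((continuous_snd.fst.continuousAt.rpow continuous_fst.continuousAt (Or.inr hx0)).mul
        (continuous_snd.snd.continuousAt.rpow (continuousAt_const.sub continuous_fst.continuousAt)
          (Or.inr hx1))).continuousWithinAt
    · intro m α a b hm hK
      exact rpow_mul_rpow_homogeneous α hm hK.2.1.1 hK.2.2.1
    · filter_upwards [self_mem_nhdsWithin, e1, e2, e3] with s hs h1 h2 h3 M hM hM1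
      obtain ⟨-, hρ, hσ⟩ := hS s hs
      have hb : ∀ A, reTrace (M * A) ≤ N A := fun A => by
        have := abs_reTrace_mul_le hM A
        rw [hM1, one_mul] at this
        exact (le_abs_self _).trans this
      exact ⟨h3, ⟨reTrace_mul_nonneg hM hρ.1, (hb _).trans h1.le⟩,
        ⟨reTrace_mul_nonneg hM hσ.1, (hb _).trans h2.le⟩⟩

lemma acl_prob_of_le_rpow {ρ σ : Matrix ι ι ℂ} (hρ : ρ.PosSemidef) {C κ : ℝ} (hκ : 0 < κ)
    (h : ∀ M : Matrix ι ι ℂ, M.PosSemidef → reTrace M = 1 →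
      reTrace (M * ρ) ≤ C * reTrace (M * σ) ^ κ) (j : POVM ι) :
    acl (j.prob ρ) (j.prob σ) := by
  intro i hi
  have hM := j.posSemidef i
  rcases (reTrace_nonneg hM).eq_or_lt with h0 | h0
  · rw [POVM.prob, eq_zero_of_reTrace_eq_zero hM h0.symm, zero_mul]
    simp [reTrace]
  · set m := reTrace (j.effect i) with hm
    have hM' : (m⁻¹ • j.effect i).PosSemidef := hM.smul (inv_nonneg.2 h0.le)
    have hM1 : reTrace (m⁻¹ • j.effect i) = 1 := by
      rw [reTrace_smul]; exact inv_mul_cancel₀ h0.ne'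
    have hpr : ∀ A, reTrace (m⁻¹ • j.effect i * A) = m⁻¹ * j.prob A i := fun A => by
      rw [Matrix.smul_mul, reTrace_smul, POVM.prob]
    have h1 := h _ hM' hM1
    rw [hpr, hpr, hi, mul_zero, Real.zero_rpow hκ.ne', mul_zero] at h1
    refine le_antisymm ?_ (j.prob_nonneg hρ i)
    exact nonpos_of_mul_nonpos_right h1 (inv_pos.2 h0)

lemma reTrace_mul_mem_Icc {M σ : Matrix ι ι ℂ} (hM : M.PosSemidef) (hM1 : reTrace M = 1)
    (hσ : σ.PosSemidef) : reTrace (M * σ) ∈ Icc 0 (∑ a, ∑ b, ‖σ a b‖) := by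
  refine ⟨reTrace_mul_nonneg hM hσ, (le_abs_self _).trans ?_⟩
  have := abs_reTrace_mul_le hM σ
  rwa [hM1, one_mul] at this

lemma eventually_mem_kappaRegion {S : Set (ℝ × Matrix ι ι ℂ × Matrix ι ι ℂ)}
    {t : ℝ × Matrix ι ι ℂ × Matrix ι ι ℂ}
    (hS : ∀ s ∈ S, PSDne s.2.1 ∧ PSDne s.2.2) {C κ α₀ α₁ : ℝ}
    (hα : ∀ᶠ s in 𝓝[S] t, s.1 ∈ Icc α₀ α₁)
    (hbd : ∀ᶠ s in 𝓝[S] t, ∀ M : Matrix ι ι ℂ, M.PosSemidef → reTrace M = 1 →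
      reTrace (M * s.2.1) ≤ C * reTrace (M * s.2.2) ^ κ) :
    ∀ᶠ s in 𝓝[S] t, ∀ M : Matrix ι ι ℂ, M.PosSemidef → reTrace M = 1 →
      (s.1, reTrace (M * s.2.1), reTrace (M * s.2.2)) ∈
        kappaRegion α₀ α₁ ((∑ a, ∑ b, ‖t.2.2 a b‖) + 1) C κ := by
  have hc : Continuous fun s : ℝ × Matrix ι ι ℂ × Matrix ι ι ℂ => ∑ a, ∑ b, ‖s.2.2 a b‖ :=
    continuous_finsetSum _ fun a _ => continuous_finsetSum _ fun b _ =>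
      (continuous_snd.snd.matrix_elem a b).norm
  have e2 : ∀ᶠ s in 𝓝[S] t, ∑ a, ∑ b, ‖s.2.2 a b‖ < (∑ a, ∑ b, ‖t.2.2 a b‖) + 1 :=
    nhdsWithin_le_nhds (hc.continuousAt.eventually (gt_mem_nhds (lt_add_one _)))
  filter_upwards [self_mem_nhdsWithin, hα, e2, hbd] with s hs h1 h2 h3 M hM hM1
  have h4 := reTrace_mul_mem_Icc hM hM1 (hS s hs).2.1
  exact ⟨h1, ⟨h4.1, h4.2.trans h2.le⟩, reTrace_mul_nonneg hM (hS s hs).1.1, h3 M hM hM1⟩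

lemma continuousWithinAt_Dmeas_of_one_lt {S : Set (ℝ × Matrix ι ι ℂ × Matrix ι ι ℂ)}
    {t : ℝ × Matrix ι ι ℂ × Matrix ι ι ℂ} (ht : t ∈ S)
    (hS : ∀ s ∈ S, 1 < s.1 ∧ PSDne s.2.1 ∧ PSDne s.2.2) {C κ : ℝ} (hκ : 0 < κ) (hC : 0 < C)
    (hκt : (1 - κ) * t.1 < 1)
    (hbd : ∀ᶠ s in 𝓝[S] t, ∀ M : Matrix ι ι ℂ, M.PosSemidef → reTrace M = 1 →
      reTrace (M * s.2.1) ≤ C * reTrace (M * s.2.2) ^ κ) :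
    ContinuousWithinAt (fun s => Dmeas s.1 s.2.1 s.2.2) S t := by
  have ht1 := (hS t ht).1
  refine continuousWithinAt_of_le_iff (J := POVM ι) ht
    (H := fun j s => Qcl s.1 (j.prob s.2.1) (j.prob s.2.2))
    (h := fun y s => reTrace s.2.1 * Real.exp ((s.1 - 1) * y)) ?_ ?_ ?_ ?_
  · filter_upwards [self_mem_nhdsWithin, hbd] with s hs hb y
    obtain ⟨hs1, hρ, hσ⟩ := hS s hs
    rw [Dmeas_le_iff]
    refine forall_congr' fun j => ?_
    rw [Dcl_le_iff_of_one_lt (j.prob_nonneg hρ.1) (j.prob_nonneg hσ.1) (j.sum_prob_pos hρ)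
      (acl_prob_of_le_rpow hρ.1 hκ hb j) hs1, j.sum_prob]
  · intro y₁ y₂ hy
    have hP := reTrace_pos (hS t ht).2.1
    refine mul_lt_mul_of_pos_left (Real.exp_lt_exp.2 ?_) hP
    exact mul_lt_mul_of_pos_left hy (by linarith)
  · intro y
    refine Continuous.continuousWithinAt ?_
    exact (continuous_reTrace.comp continuous_snd.fst).mul (Real.continuous_exp.comp
      ((continuous_fst.sub continuous_const).mul continuous_const))
  · intro ε hε
    obtain ⟨α₀, α₁, ⟨h0, h1⟩, hα⟩ : ∃ α₀ α₁, t.1 ∈ Ioo α₀ α₁ ∧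
        ∀ α ∈ Icc α₀ α₁, 0 < α ∧ (1 - κ) * α < 1 := by
      have hev : ∀ᶠ α in 𝓝 t.1, 0 < α ∧ (1 - κ) * α < 1 :=
        (lt_mem_nhds (by linarith)).and
          ((continuous_const.mul continuous_id).continuousAt.eventually (gt_mem_nhds hκt))
      obtain ⟨δ, hδ, hball⟩ := Metric.eventually_nhds_iff.1 hev
      refine ⟨t.1 - δ / 2, t.1 + δ / 2, ⟨by linarith, by linarith⟩, fun α hα => hball ?_⟩
      rw [Real.dist_eq, abs_lt]
      constructor <;> linarith [hα.1, hα.2]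
    have e3 : ∀ᶠ s in 𝓝[S] t, s.1 ∈ Icc α₀ α₁ :=
      nhdsWithin_le_nhds (continuous_fst.continuousAt.eventually (Icc_mem_nhds h0 h1))
    exact equicontinuous_sum_prob (ι := ι) (φ := fun x => x.2.1 ^ x.1 * x.2.2 ^ (1 - x.1))
      (isCompact_kappaRegion hC.le hκ.le)
      (continuousOn_rpow_mul_rpow_kappaRegion (hα α₀ ⟨le_rfl, (h0.trans h1).le⟩).1 hκ hC
        fun α h h' => (hα α ⟨h, h'⟩).2)
      zero_rpow_mul_zero_rpow
      (fun m α a b hm hK => rpow_mul_rpow_homogeneous α hm hK.2.2.1 hK.2.1.1) ht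
      (eventually_mem_kappaRegion (fun s hs => (hS s hs).2) e3 hbd) hε

lemma continuousWithinAt_Dmeas_of_eq_one {S : Set (ℝ × Matrix ι ι ℂ × Matrix ι ι ℂ)}
    {t : ℝ × Matrix ι ι ℂ × Matrix ι ι ℂ} (ht : t ∈ S)
    (hS : ∀ s ∈ S, s.1 = 1 ∧ PSDne s.2.1 ∧ PSDne s.2.2) {C κ : ℝ} (hκ : 0 < κ) (hC : 0 < C)
    (hbd : ∀ᶠ s in 𝓝[S] t, ∀ M : Matrix ι ι ℂ, M.PosSemidef → reTrace M = 1 →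
      reTrace (M * s.2.1) ≤ C * reTrace (M * s.2.2) ^ κ) :
    ContinuousWithinAt (fun s => Dmeas s.1 s.2.1 s.2.2) S t := by
  refine continuousWithinAt_of_le_iff (J := POVM ι) ht
    (H := fun j s => ∑ i, j.prob s.2.1 i * (Real.log (j.prob s.2.1 i) - Real.log (j.prob s.2.2 i)))
    (h := fun y s => reTrace s.2.1 * y) ?_ ?_ ?_ ?_
  · filter_upwards [self_mem_nhdsWithin, hbd] with s hs hb y
    obtain ⟨hs1, hρ, hσ⟩ := hS s hs
    rw [Dmeas_le_iff, hs1]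
    refine forall_congr' fun j => ?_
    rw [Dcl_one_le_iff (j.sum_prob_pos hρ) (acl_prob_of_le_rpow hρ.1 hκ hb j), j.sum_prob]
  · intro y₁ y₂ hy
    exact mul_lt_mul_of_pos_left hy (reTrace_pos (hS t ht).2.1)
  · intro y
    exact ((continuous_reTrace.comp continuous_snd.fst).mul continuous_const).continuousWithinAt
  · intro ε hε
    have e3 : ∀ᶠ s in 𝓝[S] t, s.1 ∈ Icc (1 : ℝ) 1 := by
      filter_upwards [self_mem_nhdsWithin] with s hs
      rw [(hS s hs).1]; exact ⟨le_rfl, le_rfl⟩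
    refine equicontinuous_sum_prob (ι := ι)
      (φ := fun x => x.2.1 * (Real.log x.2.1 - Real.log x.2.2))
      (isCompact_kappaRegion hC.le hκ.le) (continuousOn_relEntropy_kappaRegion hκ hC) (by simp)
      (fun m α a b hm hK => ?_) ht
      (eventually_mem_kappaRegion (fun s hs => (hS s hs).2) e3 hbd) hε
    rcases eq_or_ne a 0 with ha | ha
    · simp [ha]
    · have hb : b ≠ 0 := fun hb => ha (eq_zero_of_mem_kappaRegion hκ hK hb)
      rw [Real.log_mul hm.ne' ha, Real.log_mul hm.ne' hb]
      ring

/-- Pairs with `ρ ≤ f(σ)` satisfy a locally uniform power bound on outcome weights. -/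
lemma exists_eventually_reTrace_le_rpow {κ : ℝ} (hκ : 0 < κ) {f : ℝ → ℝ}
    (hf : IsKappaFunction κ f) {S : Set (ℝ × Matrix ι ι ℂ × Matrix ι ι ℂ)}
    (t : ℝ × Matrix ι ι ℂ × Matrix ι ι ℂ)
    (hS : ∀ s ∈ S, PSDne s.2.2 ∧ loewnerLE s.2.1 (hermApply f s.2.2)) :
    ∃ C, 0 < C ∧ ∀ᶠ s in 𝓝[S] t, ∀ M : Matrix ι ι ℂ, M.PosSemidef → reTrace M = 1 →
      reTrace (M * s.2.1) ≤ C * reTrace (M * s.2.2) ^ min κ 1 := by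
  obtain ⟨C, hC, hfC⟩ := exists_kappa_bound hκ hf (reTrace t.2.2 + 1)
  refine ⟨C + 1, by linarith, ?_⟩
  filter_upwards [self_mem_nhdsWithin, eventually_reTrace_le t] with s hs hs1 M hM hM1
  refine reTrace_mul_le_rpow (lt_min hκ one_pos) (min_le_right _ _) (by linarith) hM hM1
    (hS s hs).1.1 (hS s hs).2 fun x hx hx' => (hfC x hx (hx'.trans hs1)).trans ?_
  exact mul_le_mul_of_nonneg_right (by linarith) (Real.rpow_nonneg hx _)

lemma one_sub_min_mul_lt {κ α : ℝ} (h : (1 - κ) * α < 1) : (1 - min κ 1) * α < 1 := by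
  rcases min_choice κ 1 with h' | h' <;> rw [h']
  · exact h
  · simp

lemma Dmeas_convex {ρ σ : Matrix ι ι ℂ} (hρ : PSDne ρ) (hσ : PSDne σ) {a b t : ℝ} (ha : 1 < a)
    (hb : 1 < b) (ht : t ∈ Icc (0 : ℝ) 1) :
    ((t * a + (1 - t) * b - 1 : ℝ) : EReal) * Dmeas (t * a + (1 - t) * b) ρ σ
        + ((Real.log (reTrace ρ) : ℝ) : EReal)
      ≤ (t : EReal) * (((a - 1 : ℝ) : EReal) * Dmeas a ρ σ + ((Real.log (reTrace ρ) : ℝ) : EReal))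
        + ((1 - t : ℝ) : EReal) * (((b - 1 : ℝ) : EReal) * Dmeas b ρ σ
          + ((Real.log (reTrace ρ) : ℝ) : EReal)) := by
  rcases ht.1.eq_or_lt with rfl | ht0
  · simp
  rcases ht.2.eq_or_lt with rfl | ht1
  · simp
  have ht1' : 0 < 1 - t := by linarith
  set L := Real.log (reTrace ρ)
  have hnb : ∀ {u v : ℝ}, 0 < u → 1 < v →
      (u : EReal) * (((v - 1 : ℝ) : EReal) * Dmeas v ρ σ + (L : EReal)) ≠ ⊥ := by
    intro u v hu hv
    induction hD : Dmeas v ρ σ with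
    | bot => exact absurd hD (Dmeas_ne_bot _ _ _)
    | top =>
      rw [EReal.coe_mul_top_of_pos (by linarith), EReal.top_add_coe, EReal.coe_mul_top_of_pos hu]
      exact top_ne_bot
    | coe x => exact_mod_cast EReal.coe_ne_bot _
  by_cases hDa : Dmeas a ρ σ = ⊤
  · refine le_of_le_of_eq le_top (Eq.symm ?_)
    rw [hDa, EReal.coe_mul_top_of_pos (by linarith), EReal.top_add_coe,
      EReal.coe_mul_top_of_pos ht0, EReal.top_add_of_ne_bot (hnb ht1' hb)]
  by_cases hDb : Dmeas b ρ σ = ⊤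
  · refine le_of_le_of_eq le_top (Eq.symm ?_)
    rw [hDb, EReal.coe_mul_top_of_pos (by linarith : 0 < b - 1), EReal.top_add_coe,
      EReal.coe_mul_top_of_pos ht1', EReal.add_top_of_ne_bot (hnb ht0 ha)]
  lift Dmeas a ρ σ to ℝ using ⟨hDa, Dmeas_ne_bot _ _ _⟩ with ya hya
  lift Dmeas b ρ σ to ℝ using ⟨hDb, Dmeas_ne_bot _ _ _⟩ with yb hyb
  have hc : 1 < t * a + (1 - t) * b := by nlinarith
  have hc0 : 0 < t * a + (1 - t) * b - 1 := by linarith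
  have key : Dmeas (t * a + (1 - t) * b) ρ σ ≤
      (((t * (a - 1) * ya + (1 - t) * (b - 1) * yb) / (t * a + (1 - t) * b - 1) : ℝ) : EReal) := by
    refine Dmeas_le_iff.2 fun j => ?_
    have hp := j.prob_nonneg hρ.1
    have hq := j.prob_nonneg hσ.1
    have hP := j.sum_prob_pos hρ
    have hja := Dmeas_le_iff.1 hya.ge j
    have hjb := Dmeas_le_iff.1 hyb.ge j
    have hac : acl (j.prob ρ) (j.prob σ) := by
      by_contra hac
      rw [Dcl_eq_top_of_not_acl hac ha.le] at hja
      exact EReal.coe_ne_top _ (top_le_iff.1 hja)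
    rw [Dcl_le_iff_of_one_lt hp hq hP hac ha] at hja
    rw [Dcl_le_iff_of_one_lt hp hq hP hac hb] at hjb
    rw [Dcl_le_iff_of_one_lt hp hq hP hac hc, mul_div_cancel₀ _ hc0.ne']
    refine (Qcl_logConvex hp hq hac (by linarith) (by linarith) ht0 ht1).trans ?_
    refine (mul_le_mul (Real.rpow_le_rpow (Qcl_nonneg hp hq a) hja ht0.le)
      (Real.rpow_le_rpow (Qcl_nonneg hp hq b) hjb ht1'.le)
      (Real.rpow_nonneg (Qcl_nonneg hp hq b) _) (by positivity)).trans (le_of_eq ?_)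
    rw [Real.mul_rpow hP.le (Real.exp_pos _).le, Real.mul_rpow hP.le (Real.exp_pos _).le,
      mul_mul_mul_comm, ← Real.rpow_add hP, ← Real.exp_mul, ← Real.exp_mul, ← Real.exp_add]
    congr 2
    · simp
    · ring
  have hne : Dmeas (t * a + (1 - t) * b) ρ σ ≠ ⊤ :=
    ne_top_of_le_ne_top (EReal.coe_ne_top _) key
  lift Dmeas (t * a + (1 - t) * b) ρ σ to ℝ using ⟨hne, Dmeas_ne_bot _ _ _⟩ with yc hyc
  rw [EReal.coe_le_coe_iff, le_div_iff₀ hc0] at key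
  norm_cast
  linarith

lemma continuousAt_Dmeas_of_acl {ρ σ : Matrix ι ι ℂ} (hρ : PSDne ρ) (hσ : PSDne σ)
    (hac : ∀ j : POVM ι, acl (j.prob ρ) (j.prob σ)) {α : ℝ} (hα : 1 < α) :
    ContinuousAt (fun α => Dmeas α ρ σ) α := by
  obtain ⟨c, hc, hM⟩ := exists_dominating_const hρ.1 hσ.1 hac
  have h := continuousWithinAt_Dmeas_of_one_lt
    (S := {s : ℝ × Matrix ι ι ℂ × Matrix ι ι ℂ | 1 < s.1 ∧ s.2 = (ρ, σ)}) (t := (α, ρ, σ))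
    ⟨hα, rfl⟩ (fun s hs => ⟨hs.1, by rw [hs.2]; exact ⟨hρ, hσ⟩⟩) (C := c) one_pos (by linarith)
    (by simp) (by
      filter_upwards [self_mem_nhdsWithin] with s hs M hM' _
      rw [hs.2, Real.rpow_one]
      exact hM M hM')
  have hcomp := h.comp (s := Ioi 1) (f := fun x : ℝ => (x, ρ, σ))
    (by fun_prop) (fun x hx => ⟨hx, rfl⟩)
  exact hcomp.continuousAt (Ioi_mem_nhds hα)

lemma continuousAt_Dmeas_one {ρ σ : Matrix ι ι ℂ} (hρ : PSDne ρ) (hσ : PSDne σ) :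
    ContinuousAt (fun α => Dmeas α ρ σ) 1 := by
  have hpos : ∀ᶠ α in 𝓝 (1 : ℝ), 0 < α := lt_mem_nhds one_pos
  refine tendsto_order.2 ⟨fun y' hy' => ?_, fun y' hy' => ?_⟩
  · obtain ⟨y, hy, hy1⟩ := EReal.lt_iff_exists_real_btwn.1 hy'
    have hn := mt Dmeas_le_iff.2 (not_le.2 hy1)
    push Not at hn
    obtain ⟨j, hj⟩ := hn
    have hev := eventually_not_Dcl_le (j.prob_nonneg hρ.1) (j.prob_nonneg hσ.1)
      (j.sum_prob_pos hρ) (not_le.2 hj)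
    rw [eventually_nhdsWithin_iff] at hev
    filter_upwards [hev, hpos] with α h h0
    rcases lt_or_ge α 1 with h1 | h1
    · exact hy.trans ((not_le.1 (h h1)).trans_le (Dcl_le_Dmeas α ρ σ j))
    · exact hy'.trans_le (Dmeas_mono hρ hσ one_pos h1)
  · obtain ⟨y, hy, hy1⟩ := EReal.lt_iff_exists_real_btwn.1 hy'
    obtain ⟨z, hz, hz1⟩ := EReal.lt_iff_exists_real_btwn.1 hy1
    have hzy : y < z := EReal.coe_lt_coe_iff.1 hz
    have hac : ∀ j : POVM ι, acl (j.prob ρ) (j.prob σ) := fun j => by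
      by_contra hac
      have h := Dmeas_le_iff.1 hy.le j
      rw [Dcl_eq_top_of_not_acl hac le_rfl] at h
      exact EReal.coe_ne_top _ (top_le_iff.1 h)
    obtain ⟨c, hc, hM⟩ := exists_dominating_const hρ.1 hσ.1 hac
    set e : ℝ → ℝ := fun α => y + (4 * (α - 1) + c * Real.log c *
      (Real.exp ((α - 1) * Real.log c) - 1)) * reTrace σ / reTrace ρ with he
    have hec : Continuous e := by fun_prop
    have he1 : e 1 = y := by simp [he]
    have hev : ∀ᶠ α in 𝓝 (1 : ℝ), e α < z :=
      hec.continuousAt.eventually (gt_mem_nhds (by rw [he1]; exact hzy))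
    filter_upwards [hev, hpos] with α h h0
    rcases le_or_gt α 1 with h1 | h1
    · exact (Dmeas_mono hρ hσ h0 h1).trans_lt hy'
    · refine lt_of_le_of_lt (Dmeas_le_iff.2 fun j => ?_)
        ((EReal.coe_lt_coe_iff.2 h).trans hz1)
      have h2 := Dcl_one_add_le (j.prob_nonneg hρ.1) (j.prob_nonneg hσ.1) (j.sum_prob_pos hρ) hc
        (fun i => hM _ (j.posSemidef i)) (Dmeas_le_iff.1 hy.le j) (sub_pos.2 h1)
      rwa [j.sum_prob, j.sum_prob, add_sub_cancel] at h2

lemma continuousOn_Dmeas_order {ρ σ : Matrix ι ι ℂ} (hρ : PSDne ρ) (hσ : PSDne σ) :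
    ContinuousOn (fun α => Dmeas α ρ σ) (Ioi 0) := by
  intro α hα
  refine ContinuousAt.continuousWithinAt ?_
  rcases lt_trichotomy α 1 with h1 | rfl | h1
  · have h := continuousWithinAt_Dmeas_of_lt_one
      (S := {s : ℝ × Matrix ι ι ℂ × Matrix ι ι ℂ | s.1 ∈ Ioo 0 1 ∧ s.2 = (ρ, σ)}) (t := (α, ρ, σ))
      ⟨⟨hα, h1⟩, rfl⟩ (fun s hs => ⟨hs.1, by rw [hs.2]; exact ⟨hρ, hσ⟩⟩)
    have hcomp := h.comp (s := Ioo 0 1) (f := fun x : ℝ => (x, ρ, σ))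
      (by fun_prop) (fun x hx => ⟨hx, rfl⟩)
    exact hcomp.continuousAt (Ioo_mem_nhds hα h1)
  · exact continuousAt_Dmeas_one hρ hσ
  · by_cases hac : ∀ j : POVM ι, acl (j.prob ρ) (j.prob σ)
    · exact continuousAt_Dmeas_of_acl hρ hσ hac h1
    · push Not at hac
      obtain ⟨j, hj⟩ := hac
      refine (continuousAt_const (y := (⊤ : EReal))).congr ?_
      filter_upwards [lt_mem_nhds h1] with β hβ
      refine (top_le_iff.1 ?_).symm
      rw [← Dcl_eq_top_of_not_acl hj hβ.le]
      exact Dcl_le_Dmeas β ρ σ j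

end MeasuredContinuity

/-- Continuity and monotonicity properties of the measured Rényi
divergences, parallel to the classical case. -/
theorem measured_renyi_continuity (n : ℕ) (κ : ℝ) (hκ : 0 < κ) (f : ℝ → ℝ)
    (hf : IsKappaFunction κ f) :
    -- (a)
    ContinuousOn
      (fun t : ℝ × Matrix (Fin n) (Fin n) ℂ × Matrix (Fin n) (Fin n) ℂ =>
        Dmeas t.1 t.2.1 t.2.2)
      {t : ℝ × Matrix (Fin n) (Fin n) ℂ × Matrix (Fin n) (Fin n) ℂ |
        t.1 ∈ Set.Ioo (0 : ℝ) 1 ∧ PSDne t.2.1 ∧ PSDne t.2.2} ∧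
    -- (b)
    ContinuousOn
      (fun t : ℝ × Matrix (Fin n) (Fin n) ℂ × Matrix (Fin n) (Fin n) ℂ =>
        Dmeas t.1 t.2.1 t.2.2)
      {t : ℝ × Matrix (Fin n) (Fin n) ℂ × Matrix (Fin n) (Fin n) ℂ |
        1 < t.1 ∧ (1 - κ) * t.1 < 1 ∧ PSDne t.2.1 ∧ PSDne t.2.2 ∧
        loewnerLE t.2.1 (hermApply f t.2.2)} ∧
    -- (c)
    (∀ α : ℝ, α ∈ Set.Ioo (0 : ℝ) 1 →
      ContinuousOn
        (fun p : Matrix (Fin n) (Fin n) ℂ × Matrix (Fin n) (Fin n) ℂ => Dmeas α p.1 p.2)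
        {p : Matrix (Fin n) (Fin n) ℂ × Matrix (Fin n) (Fin n) ℂ | PSDne p.1 ∧ PSDne p.2}) ∧
    (∀ α : ℝ, 0 < α → (1 - κ) * α < 1 →
      ContinuousOn
        (fun p : Matrix (Fin n) (Fin n) ℂ × Matrix (Fin n) (Fin n) ℂ => Dmeas α p.1 p.2)
        {p : Matrix (Fin n) (Fin n) ℂ × Matrix (Fin n) (Fin n) ℂ |
          PSDne p.1 ∧ PSDne p.2 ∧ loewnerLE p.1 (hermApply f p.2)}) ∧
    -- (d)
    (∀ ρ σ : Matrix (Fin n) (Fin n) ℂ, PSDne ρ → PSDne σ →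
      (∀ a ∈ Set.Ioi (1 : ℝ), ∀ b ∈ Set.Ioi (1 : ℝ), ∀ t ∈ Set.Icc (0 : ℝ) 1,
        ((t * a + (1 - t) * b - 1 : ℝ) : EReal) * Dmeas (t * a + (1 - t) * b) ρ σ
            + ((Real.log (reTrace ρ) : ℝ) : EReal)
          ≤ (t : EReal) * (((a - 1 : ℝ) : EReal) * Dmeas a ρ σ
                + ((Real.log (reTrace ρ) : ℝ) : EReal))
            + ((1 - t : ℝ) : EReal) * (((b - 1 : ℝ) : EReal) * Dmeas b ρ σ
                + ((Real.log (reTrace ρ) : ℝ) : EReal))) ∧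
      (∀ a ∈ Set.Ioi (0 : ℝ), ∀ b ∈ Set.Ioi (0 : ℝ), a ≤ b → Dmeas a ρ σ ≤ Dmeas b ρ σ) ∧
      ContinuousOn (fun α : ℝ => Dmeas α ρ σ) (Set.Ioi (0 : ℝ))) := by
  refine ⟨fun t ht => continuousWithinAt_Dmeas_of_lt_one ht fun s hs => hs, fun t ht => ?_,
    fun α hα p hp => ?_, fun α hα hκα p hp => ?_, fun ρ σ hρ hσ =>
      ⟨fun a ha b hb t ht => Dmeas_convex hρ hσ ha hb ht,
        fun a ha b _ hab => Dmeas_mono hρ hσ ha hab, continuousOn_Dmeas_order hρ hσ⟩⟩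
  · obtain ⟨C, hC, hbd⟩ := exists_eventually_reTrace_le_rpow hκ hf t
      (fun s (hs : s ∈ {t : ℝ × Matrix (Fin n) (Fin n) ℂ × Matrix (Fin n) (Fin n) ℂ |
        1 < t.1 ∧ (1 - κ) * t.1 < 1 ∧ PSDne t.2.1 ∧ PSDne t.2.2 ∧
        loewnerLE t.2.1 (hermApply f t.2.2)}) => hs.2.2.2)
    exact continuousWithinAt_Dmeas_of_one_lt ht (fun s hs => ⟨hs.1, hs.2.2.1, hs.2.2.2.1⟩)
      (lt_min hκ one_pos) hC (one_sub_min_mul_lt ht.2.1) hbd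
  · have h := continuousWithinAt_Dmeas_of_lt_one
      (S := {s : ℝ × Matrix (Fin n) (Fin n) ℂ × Matrix (Fin n) (Fin n) ℂ |
        s.1 ∈ Ioo 0 1 ∧ PSDne s.2.1 ∧ PSDne s.2.2}) (t := (α, p)) ⟨hα, hp⟩ (fun s hs => hs)
    exact h.comp (f := fun p => (α, p)) (by fun_prop) (fun x hx => ⟨hα, hx⟩)
  · set S : Set (ℝ × Matrix (Fin n) (Fin n) ℂ × Matrix (Fin n) (Fin n) ℂ) :=
      {s | s.1 = α ∧ PSDne s.2.1 ∧ PSDne s.2.2 ∧ loewnerLE s.2.1 (hermApply f s.2.2)}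
    have hpS : (α, p) ∈ S := ⟨rfl, hp⟩
    obtain ⟨C, hC, hbd⟩ := exists_eventually_reTrace_le_rpow hκ hf (S := S) (α, p)
      (fun s hs => hs.2.2)
    have h : ContinuousWithinAt (fun s => Dmeas s.1 s.2.1 s.2.2) S (α, p) := by
      rcases lt_trichotomy α 1 with h1 | h1 | h1
      · exact continuousWithinAt_Dmeas_of_lt_one hpS
          fun s hs => ⟨by rw [hs.1]; exact ⟨hα, h1⟩, hs.2.1, hs.2.2.1⟩
      · exact continuousWithinAt_Dmeas_of_eq_one hpS
          (fun s hs => ⟨hs.1.trans h1, hs.2.1, hs.2.2.1⟩) (lt_min hκ one_pos) hC hbd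
      · exact continuousWithinAt_Dmeas_of_one_lt hpS
          (fun s hs => ⟨by rw [hs.1]; exact h1, hs.2.1, hs.2.2.1⟩) (lt_min hκ one_pos) hC
          (one_sub_min_mul_lt hκα) hbd
    exact h.comp (f := fun p => (α, p)) (by fun_prop) (fun x hx => ⟨rfl, hx⟩)

end QRenyi

end
end

section
/- For every γ > 0 there exist two sequences (ρ_n)_{n∈ℕ} and (σ_n)_{n∈ℕ} of 2×2 complex density matrices (qubit states) such that lim_{n→∞} D_max(ρ_n‖σ_n) = 0, while lim_{n→∞} D_{α,z}(ρ_n‖σ_n) = +∞ whenever (α > 2+γ and z ∈ (0,1]) or (α > 1 + z(1+γ) and z > 1). -/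
open Filter Set Topology
open scoped ComplexOrder

noncomputable section

namespace QRenyi

attribute [local instance] Classical.propDecidable

variable {ι : Type*} [Fintype ι] [DecidableEq ι]

/-- If a Hermitian matrix is annihilated by `(t - a) (t - b)`, then a function of it is given by the
affine function interpolating at `a` and `b`. -/
lemma hermApply_eq_affine {A : Matrix ι ι ℂ} (hA : A.IsHermitian) {a b u w : ℝ} {f : ℝ → ℝ}
    (h : A * A = (a + b) • A - (a * b) • (1 : Matrix ι ι ℂ))
    (ha : f a = u * a + w) (hb : f b = u * b + w) :
    hermApply f A = u • A + w • (1 : Matrix ι ι ℂ) := by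
  have hs : IsSelfAdjoint A := hA
  have hlin : ∀ c d : ℝ, cfc (fun t : ℝ => c * t + d) A = c • A + d • (1 : Matrix ι ι ℂ) := by
    intro c d
    rw [cfc_add_const .., cfc_const_mul_id .., Algebra.algebraMap_eq_smul_one]
  have hsq : cfc (fun t : ℝ => t * t) A = cfc (fun t : ℝ => (a + b) * t + -(a * b)) A := by
    rw [hlin, cfc_mul .., cfc_id' ℝ A, h, neg_smul, sub_eq_add_neg]
  have hspec : ∀ t ∈ spectrum ℝ A, t = a ∨ t = b := by
    intro t ht
    have : t * t = (a + b) * t + -(a * b) := (eqOn_of_cfc_eq_cfc hsq) ht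
    have h0 : (t - a) * (t - b) = 0 := by
      linarith
    rcases mul_eq_zero.1 h0 with h0 | h0
    · exact Or.inl (by linarith)
    · exact Or.inr (by linarith)
  rw [hermApply, dif_pos hA, ← hA.cfc_eq, ← hlin]
  refine cfc_congr fun t ht => ?_
  rcases hspec t ht with rfl | rfl
  · exact ha
  · exact hb

/-- The rank-one operator `|v⟩⟨v|` of the real vector `v = (x, y)`. -/
def rankOne (x y : ℝ) : Matrix (Fin 2) (Fin 2) ℂ :=
  !![((x * x : ℝ) : ℂ), ((x * y : ℝ) : ℂ); ((x * y : ℝ) : ℂ), ((y * y : ℝ) : ℂ)]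

/-- The real diagonal qubit operator with entries `a` and `b`. -/
def diagTwo (a b : ℝ) : Matrix (Fin 2) (Fin 2) ℂ := !![(a : ℂ), 0; 0, (b : ℂ)]

lemma rankOne_posSemidef (x y : ℝ) : (rankOne x y).PosSemidef := by
  have h : rankOne x y = Matrix.vecMulVec ![(x : ℂ), (y : ℂ)] (star ![(x : ℂ), (y : ℂ)]) := by
    ext i j
    fin_cases i <;> fin_cases j <;> simp [rankOne, Matrix.vecMulVec_apply, mul_comm]
  rw [h]
  exact Matrix.posSemidef_vecMulVec_self_star _

lemma trace_rankOne (x y : ℝ) : (rankOne x y).trace = ((x * x + y * y : ℝ) : ℂ) := by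
  simp [rankOne, Matrix.trace_fin_two]

lemma diagTwo_posSemidef {a b : ℝ} (ha : 0 ≤ a) (hb : 0 ≤ b) : (diagTwo a b).PosSemidef := by
  have h : diagTwo a b = Matrix.diagonal ![(a : ℂ), (b : ℂ)] := by
    ext i j
    fin_cases i <;> fin_cases j <;> simp [diagTwo]
  rw [h, Matrix.posSemidef_diagonal_iff]
  intro i
  fin_cases i <;> simpa

lemma trace_diagTwo (a b : ℝ) : (diagTwo a b).trace = ((a + b : ℝ) : ℂ) := by
  simp [diagTwo, Matrix.trace_fin_two]

lemma diagTwo_mul_rankOne_mul_diagTwo (a b x y : ℝ) :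
    diagTwo a b * rankOne x y * diagTwo a b = rankOne (a * x) (b * y) := by
  ext i j
  fin_cases i <;> fin_cases j <;> simp [diagTwo, rankOne, Matrix.mul_apply] <;> ring

lemma matPow_rankOne {x y : ℝ} (h : 0 < x * x + y * y) (r : ℝ) :
    matPow (rankOne x y) r =
      ((x * x + y * y) ^ r / (x * x + y * y)) • rankOne x y := by
  rw [matPow, hermApply_eq_affine (rankOne_posSemidef x y).isHermitian
    (a := x * x + y * y) (b := 0) (w := 0) (u := (x * x + y * y) ^ r / (x * x + y * y)),
    zero_smul, add_zero]
  · ext i j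
    fin_cases i <;> fin_cases j <;> simp [rankOne, Matrix.mul_apply] <;> ring
  · rw [if_neg h.ne', div_mul_cancel₀ _ h.ne', add_zero]
  · simp

lemma matPow_diagTwo {a b : ℝ} (ha : 0 < a) (hb : 0 < b) (hab : a ≠ b) (r : ℝ) :
    matPow (diagTwo a b) r = diagTwo (a ^ r) (b ^ r) := by
  have hab' : a - b ≠ 0 := sub_ne_zero.2 hab
  rw [matPow, hermApply_eq_affine (diagTwo_posSemidef ha.le hb.le).isHermitian
    (a := a) (b := b) (u := (a ^ r - b ^ r) / (a - b))
    (w := a ^ r - (a ^ r - b ^ r) / (a - b) * a)]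
  · ext i j
    fin_cases i <;> fin_cases j <;> simp [diagTwo]
    have : (a : ℂ) - b ≠ 0 := by exact_mod_cast hab'
    field_simp
    ring
  · ext i j
    fin_cases i <;> fin_cases j <;> simp [diagTwo, Matrix.mul_apply] <;> ring
  · rw [if_neg ha.ne']
    ring
  · rw [if_neg hb.ne']
    field_simp
    ring

lemma Qaz_rankOne_diagTwo {x y a b α z : ℝ} (hxy : x * x + y * y = 1) (hx : 0 < x) (ha : 0 < a)
    (hb : 0 < b) (hab : a ≠ b) :
    Qaz α z (rankOne x y) (diagTwo a b) =
      (x * x * a ^ ((1 - α) / z) + y * y * b ^ ((1 - α) / z)) ^ z := by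
  have hsq : ∀ c : ℝ, 0 < c →
      c ^ ((1 - α) / (2 * z)) * c ^ ((1 - α) / (2 * z)) = c ^ ((1 - α) / z) := by
    intro c hc
    rw [← Real.rpow_add hc]
    congr 1
    rw [mul_comm 2 z, ← div_div]
    ring
  have hax : 0 < a ^ ((1 - α) / (2 * z)) * x := by positivity
  have hpos : 0 < a ^ ((1 - α) / (2 * z)) * x * (a ^ ((1 - α) / (2 * z)) * x) +
      b ^ ((1 - α) / (2 * z)) * y * (b ^ ((1 - α) / (2 * z)) * y) :=
    add_pos_of_pos_of_nonneg (mul_pos hax hax) (mul_self_nonneg _)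
  rw [Qaz, matPow_rankOne (by rw [hxy]; exact one_pos), hxy, Real.one_rpow, div_one, one_smul,
    matPow_diagTwo ha hb hab, diagTwo_mul_rankOne_mul_diagTwo, matPow_rankOne hpos, reTrace,
    Matrix.trace_smul, trace_rankOne, Complex.real_smul, ← Complex.ofReal_mul, Complex.ofReal_re,
    div_mul_cancel₀ _ hpos.ne', ← hsq a ha, ← hsq b hb]
  congr 1
  ring

lemma Daz_rankOne_diagTwo_ge {x y a b α z : ℝ} (hxy : x * x + y * y = 1) (hx : 0 < x) (hy : 0 < y)
    (ha : 0 < a) (hb : 0 < b) (hab : a ≠ b) (hα : 1 < α) (hz : 0 < z) :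
    (((α - 1)⁻¹ * (z * Real.log (y * y * b ^ ((1 - α) / z))) : ℝ) : EReal) ≤
      Daz α z (rankOne x y) (diagTwo a b) := by
  rw [Daz]
  split_ifs with h
  · have hα' : 0 < α - 1 := by linarith
    have hyb : 0 < y * y * b ^ ((1 - α) / z) := by positivity
    have hxa : 0 < x * x * a ^ ((1 - α) / z) := by positivity
    rw [Qaz_rankOne_diagTwo hxy hx ha hb hab, reTrace, trace_rankOne, hxy, Complex.ofReal_re,
      Real.log_one, sub_zero, Real.log_rpow (by positivity), EReal.coe_le_coe_iff]
    gcongr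
    linarith
  · exact le_top

lemma loewnerLE_rankOne_diagTwo {x y a b d : ℝ} (ha : 0 < a) (hb : 0 < b) (hd : 0 ≤ d)
    (hy : 0 ≤ y) (hyb : y * y = b * d) :
    loewnerLE (rankOne x y) ((x * x / a + d) • diagTwo a b) := by
  have h : (x * x / a + d) • diagTwo a b - rankOne x y =
      rankOne (√(d * a)) (-(√(b / a) * x)) := by
    have h1 : √(d * a) * √(d * a) = d * a := Real.mul_self_sqrt (by positivity)
    have h2 : √(b / a) * √(b / a) = b / a := Real.mul_self_sqrt (by positivity)
    have h3 : √(d * a) * √(b / a) = y := by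
      rw [← Real.sqrt_mul (by positivity), ← Real.sqrt_mul_self hy, hyb]
      congr 1
      field_simp
    have e1 : (x * x / a + d) * a - x * x = √(d * a) * √(d * a) := by
      rw [h1]
      field_simp
      ring
    have e2 : -(x * y) = √(d * a) * -(√(b / a) * x) := by
      rw [← h3]
      ring
    have e3 : (x * x / a + d) * b - y * y = -(√(b / a) * x) * -(√(b / a) * x) := by
      have : -(√(b / a) * x) * -(√(b / a) * x) = √(b / a) * √(b / a) * (x * x) := by ring
      rw [this, h2, hyb]
      field_simp
      ring
    rw [rankOne, rankOne, ← e1, ← e2, ← e3]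
    ext i j
    fin_cases i <;> fin_cases j <;> simp [diagTwo]
  rw [loewnerLE, h]
  exact rankOne_posSemidef _ _

/-- A bound on `D_max` of two states from a single admissible constant. -/
lemma exists_Dmax_eq_of_loewnerLE {κ : Type*} [Fintype κ] {ρ σ : Matrix κ κ ℂ} (hρ : ρ.trace = 1) (hσ : σ.trace = 1)
    {c : ℝ} (hc : 0 < c) (h : loewnerLE ρ (c • σ)) :
    ∃ m : ℝ, Dmax ρ σ = (m : EReal) ∧ 0 ≤ m ∧ m ≤ Real.log c := by
  have hone : ∀ d ∈ {d : ℝ | 0 < d ∧ loewnerLE ρ (d • σ)}, 1 ≤ d := by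
    rintro d ⟨-, hd⟩
    have := hd.trace_nonneg
    rw [Matrix.trace_sub, Matrix.trace_smul, hρ, hσ, Complex.real_smul, mul_one] at this
    have h' : (0 : ℝ) ≤ d - 1 := by exact_mod_cast this
    linarith
  have hmem : c ∈ {d : ℝ | 0 < d ∧ loewnerLE ρ (d • σ)} := ⟨hc, h⟩
  have hinf : 1 ≤ sInf {d : ℝ | 0 < d ∧ loewnerLE ρ (d • σ)} := le_csInf ⟨c, hmem⟩ hone
  refine ⟨_, by rw [Dmax, if_pos ⟨c, hc, h⟩], Real.log_nonneg hinf, ?_⟩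
  exact Real.log_le_log (by linarith) (csInf_le ⟨1, hone⟩ hmem)

/-- For every `γ > 0`, there are sequences of qubit states whose
max-relative entropies tend to `0` while `D_{α,z}` tends to `+∞` for the indicated
parameter ranges. -/
theorem exists_qubit_sequences_Dmax_to_zero_Daz_to_top (γ : ℝ) (hγ : 0 < γ) :
    ∃ ρ σ : ℕ → Matrix (Fin 2) (Fin 2) ℂ,
      (∀ k, (ρ k).PosSemidef ∧ (ρ k).trace = 1) ∧
      (∀ k, (σ k).PosSemidef ∧ (σ k).trace = 1) ∧
      Filter.Tendsto (fun k => Dmax (ρ k) (σ k)) Filter.atTop (𝓝 (0 : EReal)) ∧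
      ∀ α z : ℝ,
        ((2 + γ < α ∧ z ∈ Set.Ioc (0 : ℝ) 1) ∨ (1 + z * (1 + γ) < α ∧ 1 < z)) →
        Filter.Tendsto (fun k => Daz α z (ρ k) (σ k)) Filter.atTop (𝓝 (⊤ : EReal)) := by
  have hs0 : ∀ k : ℕ, (0 : ℝ) < 1 / (k + 3) := fun k => by positivity
  have hs1 : ∀ k : ℕ, (1 : ℝ) / (k + 3) < 1 / 2 := fun k => by
    apply one_div_lt_one_div_of_lt <;> linarith [k.cast_nonneg (α := ℝ)]
  have hslim : Tendsto (fun k : ℕ => (1 : ℝ) / (k + 3)) atTop (𝓝 0) := by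
    simpa [Function.comp_def] using
      (tendsto_const_div_atTop_nhds_zero_nat (1 : ℝ)).comp (tendsto_add_atTop_nat 3)
  set s : ℕ → ℝ := fun k => 1 / (k + 3) with hs
  have hd0 : ∀ k, 0 < s k ^ γ := fun k => Real.rpow_pos_of_pos (hs0 k) γ
  have hd1 : ∀ k, s k ^ γ < 1 := fun k =>
    Real.rpow_lt_one (hs0 k).le (by linarith [hs1 k]) hγ
  have hq0 : ∀ k, 0 < s k * s k ^ γ := fun k => mul_pos (hs0 k) (hd0 k)
  have hp0 : ∀ k, 0 < 1 - s k * s k ^ γ := fun k => by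
    have : s k * s k ^ γ ≤ s k * 1 := mul_le_mul_of_nonneg_left (hd1 k).le (hs0 k).le
    linarith [hs1 k]
  have hxx : ∀ k, √(1 - s k * s k ^ γ) * √(1 - s k * s k ^ γ) = 1 - s k * s k ^ γ :=
    fun k => Real.mul_self_sqrt (hp0 k).le
  have hyy : ∀ k, √(s k * s k ^ γ) * √(s k * s k ^ γ) = s k * s k ^ γ :=
    fun k => Real.mul_self_sqrt (hq0 k).le
  have hxy : ∀ k, √(1 - s k * s k ^ γ) * √(1 - s k * s k ^ γ) +
      √(s k * s k ^ γ) * √(s k * s k ^ γ) = 1 := fun k => by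
    rw [hxx, hyy]
    ring
  have ha0 : ∀ k, 0 < 1 - s k := fun k => by linarith [hs1 k]
  have htρ : ∀ k, (rankOne √(1 - s k * s k ^ γ) √(s k * s k ^ γ)).trace = 1 := fun k => by
    rw [trace_rankOne, hxy, Complex.ofReal_one]
  have htσ : ∀ k, (diagTwo (1 - s k) (s k)).trace = 1 := fun k => by
    rw [trace_diagTwo, sub_add_cancel, Complex.ofReal_one]
  refine ⟨fun k => rankOne √(1 - s k * s k ^ γ) √(s k * s k ^ γ), fun k => diagTwo (1 - s k) (s k),
    fun k => ⟨rankOne_posSemidef _ _, htρ k⟩,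
    fun k => ⟨diagTwo_posSemidef (ha0 k).le (hs0 k).le, htσ k⟩, ?_, ?_⟩
  · have hle := fun k => loewnerLE_rankOne_diagTwo (ha0 k) (hs0 k) (hd0 k).le
      (x := √(1 - s k * s k ^ γ)) (Real.sqrt_nonneg _) (hyy k)
    simp only [hxx] at hle
    choose m hm hm0 hm1 using fun k => exists_Dmax_eq_of_loewnerLE (htρ k) (htσ k)
      (add_pos (div_pos (hp0 k) (ha0 k)) (hd0 k)) (hle k)
    simp only [hm]
    rw [← EReal.coe_zero, EReal.tendsto_coe]
    refine tendsto_of_tendsto_of_tendsto_of_le_of_le tendsto_const_nhds ?_ hm0 hm1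
    have hdlim : Tendsto (fun k => s k ^ γ) atTop (𝓝 0) := by
      simpa [Real.zero_rpow hγ.ne'] using hslim.rpow_const (p := γ) (Or.inr hγ.le)
    have hc : Tendsto (fun k => (1 - s k * s k ^ γ) / (1 - s k) + s k ^ γ) atTop
        (𝓝 ((1 - 0 * 0) / (1 - 0) + 0)) :=
      (((hslim.mul hdlim).const_sub 1).div (hslim.const_sub 1) (by norm_num)).add hdlim
    have := hc.log (by norm_num)
    simpa using this
  · intro α z hαz
    have hz : 0 < z := by
      rcases hαz with ⟨-, h, -⟩ | ⟨-, h⟩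
      · exact h
      · linarith
    have hα : z * (1 + γ) < α - 1 := by
      rcases hαz with ⟨h1, -, h2⟩ | ⟨h, -⟩
      · nlinarith
      · linarith
    have hα1 : 1 < α := by nlinarith [mul_pos hz hγ]
    have hβ : 0 < (α - 1) / z - (1 + γ) := by
      rw [sub_pos, lt_div_iff₀ hz]
      linarith
    have hlog : Tendsto (fun k => -Real.log (s k)) atTop atTop :=
      tendsto_neg_atBot_atTop.comp (Real.tendsto_log_nhdsGT_zero.comp
        (tendsto_nhdsWithin_iff.2 ⟨hslim, Eventually.of_forall hs0⟩))
    have hreal : Tendsto (fun k => (α - 1)⁻¹ * (z * Real.log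
        (√(s k * s k ^ γ) * √(s k * s k ^ γ) * s k ^ ((1 - α) / z)))) atTop atTop := by
      have hpos : 0 < (α - 1)⁻¹ * (z * ((α - 1) / z - (1 + γ))) :=
        mul_pos (inv_pos.2 (by linarith)) (mul_pos hz hβ)
      refine (hlog.const_mul_atTop hpos).congr fun k => ?_
      rw [hyy, Real.log_mul (hq0 k).ne' (Real.rpow_pos_of_pos (hs0 k) _).ne',
        Real.log_mul (hs0 k).ne' (hd0 k).ne', Real.log_rpow (hs0 k), Real.log_rpow (hs0 k)]
      ring
    refine tendsto_nhds_top_mono (EReal.tendsto_coe_nhds_top_iff.2 hreal)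
      (Eventually.of_forall fun k => ?_)
    exact Daz_rankOne_diagTwo_ge (hxy k) (Real.sqrt_pos.2 (hp0 k)) (Real.sqrt_pos.2 (hq0 k))
      (ha0 k) (hs0 k) (by linarith [hs1 k]) hα1 hz

end QRenyi

end
end

section
/- Let ℋ be a finite-dimensional complex Hilbert space with dim ℋ ≥ 2, and let λ ∈ (1,∞) and κ ∈ (0,∞). Then there exist two sequences of density operators ρ_n, σ_n on ℋ, where each ρ_n is a rank-one projection (pure state) and each σ_n is invertible (full rank), such that: (i) lim_{n→∞} ρ_n = lim_{n→∞} σ_n; (ii) lim_{n→∞} D_max(ρ_n‖σ_n^κ) = log λ; (iii) for every α ∈ (1,∞), lim_{n→∞} D_{α,(α−1)/κ}(ρ_n‖σ_n) = κ⁻¹ log λ > 0; and (iv) if moreover κ ∈ (0,1], then D_max(ρ_n‖σ_n) converges to log λ when κ = 1 and to +∞ when κ ∈ (0,1). -/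
open Filter Set Topology
open scoped ComplexOrder

noncomputable section

namespace QRenyi

attribute [local instance] Classical.propDecidable

variable {ι : Type*} [Fintype ι] [DecidableEq ι]

theorem hermApply_eq_smul {A : Matrix ι ι ℂ} (hA : A.IsHermitian) {f : ℝ → ℝ} {r c : ℝ}
    (hAA : A * A = r • A) (h0 : f 0 = 0) (hr : f r = c * r) : hermApply f A = c • A := by
  have heig (j : ι) : hA.eigenvalues j * hA.eigenvalues j = r * hA.eigenvalues j := by
    have h := hA.mulVec_eigenvectorBasis j
    have hne : (⇑(hA.eigenvectorBasis j) : ι → ℂ) ≠ 0 := by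
      intro hz
      exact hA.eigenvectorBasis.orthonormal.ne_zero j (by ext i; simpa using congrFun hz i)
    have h2 := congrArg (fun M => M.mulVec (⇑(hA.eigenvectorBasis j) : ι → ℂ)) hAA
    simp only [← Matrix.mulVec_mulVec, Matrix.smul_mulVec, h, Matrix.mulVec_smul, smul_smul] at h2
    exact smul_left_injective ℝ hne h2
  have hcongr : hA.cfc f = hA.cfc (c * ·) := by
    have : f ∘ hA.eigenvalues = (c * ·) ∘ hA.eigenvalues := by
      funext j
      rcases eq_or_ne (hA.eigenvalues j) 0 with h | h
      · simp [h, h0]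
      · simp [mul_right_cancel₀ h (heig j), hr]
    rw [Matrix.IsHermitian.cfc, this, ← Matrix.IsHermitian.cfc]
  rw [hermApply, dif_pos hA, hcongr, ← hA.cfc_eq]
  exact cfc_const_mul_id c A hA

theorem hermApply_diagonal (f : ℝ → ℝ) (d : ι → ℝ) :
    hermApply f (Matrix.diagonal fun i => (d i : ℂ)) = Matrix.diagonal fun i => (f (d i) : ℂ) := by
  have hA : (Matrix.diagonal fun i => (d i : ℂ)).IsHermitian :=
    Matrix.isHermitian_diagonal_of_self_adjoint _ (by ext i; simp)
  rw [hermApply, dif_pos hA, Matrix.IsHermitian.cfc, Unitary.conjStarAlgAut_apply]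
  have key : (hA.eigenvectorUnitary : Matrix ι ι ℂ) *
        Matrix.diagonal (RCLike.ofReal ∘ f ∘ hA.eigenvalues) =
      Matrix.diagonal (fun i => (f (d i) : ℂ)) * (hA.eigenvectorUnitary : Matrix ι ι ℂ) := by
    ext i j
    have h := congrFun (hA.mulVec_eigenvectorBasis j) i
    rw [Matrix.mulVec_diagonal, Pi.smul_apply, Complex.real_smul] at h
    rw [Matrix.mul_diagonal, Matrix.diagonal_mul, Matrix.IsHermitian.eigenvectorUnitary_apply]
    rcases eq_or_ne (hA.eigenvectorBasis j i) 0 with h0 | h0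
    · simp [h0]
    · have : d i = hA.eigenvalues j := Complex.ofReal_injective (mul_right_cancel₀ h0 h)
      simp [this, mul_comm]
  rw [key, mul_assoc, Unitary.mul_star_self_of_mem hA.eigenvectorUnitary.2, mul_one]

/-- The positive multiple of a pure state with real amplitude vector `v`. -/
def realPure (v : ι → ℝ) : Matrix ι ι ℂ :=
  Matrix.vecMulVec (fun i => (v i : ℂ)) (fun i => (v i : ℂ))

/-- The diagonal complex matrix with real diagonal `s`. -/
def realDiag (s : ι → ℝ) : Matrix ι ι ℂ := Matrix.diagonal fun i => (s i : ℂ)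

theorem posSemidef_realPure {ι : Type*} [Fintype ι] (v : ι → ℝ) : (realPure v).PosSemidef := by
  have h : star (fun i => (v i : ℂ)) = fun i => (v i : ℂ) := by ext i; simp
  have := Matrix.posSemidef_vecMulVec_self_star (fun i => (v i : ℂ))
  rwa [h] at this

theorem trace_realPure {ι : Type*} [Fintype ι] (v : ι → ℝ) : (realPure v).trace = ((∑ i, v i ^ 2 : ℝ) : ℂ) := by
  simp [realPure, Matrix.trace_vecMulVec, dotProduct, sq]

theorem realPure_mul_self {ι : Type*} [Fintype ι] (v : ι → ℝ) :
    realPure v * realPure v = (∑ i, v i ^ 2) • realPure v := by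
  ext i j
  simp only [realPure, Matrix.vecMulVec_mul_vecMulVec, Matrix.smul_apply, Matrix.vecMulVec_apply,
    Complex.real_smul, dotProduct, Pi.smul_apply, smul_eq_mul]
  push_cast
  simp only [sq]
  ring

theorem realDiag_mul_realPure_mul_realDiag (s v : ι → ℝ) :
    realDiag s * realPure v * realDiag s = realPure (s * v) := by
  ext i j
  simp [realDiag, realPure, Matrix.mul_diagonal, Matrix.diagonal_mul, Matrix.vecMulVec_apply]
  ring

theorem matPow_realDiag {s : ι → ℝ} (hs : ∀ i, 0 < s i) (x : ℝ) :
    matPow (realDiag s) x = realDiag fun i => s i ^ x := by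
  simp [matPow, realDiag, hermApply_diagonal, (hs _).ne']

theorem matPow_realPure {v : ι → ℝ} (hv : 0 < ∑ i, v i ^ 2) (x : ℝ) :
    matPow (realPure v) x = (∑ i, v i ^ 2) ^ (x - 1) • realPure v := by
  refine hermApply_eq_smul (posSemidef_realPure v).1 (realPure_mul_self v) (by simp) ?_
  rw [if_neg hv.ne', Real.rpow_sub_one hv.ne', div_mul_cancel₀ _ hv.ne']

theorem posDef_realDiag {ι : Type*} [DecidableEq ι] {s : ι → ℝ} (hs : ∀ i, 0 < s i) : (realDiag s).PosDef :=
  Matrix.posDef_diagonal_iff.2 fun i => by exact_mod_cast hs i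

theorem loewnerLE_realPure_realDiag_iff {s v : ι → ℝ} (hs : ∀ i, 0 < s i)
    (hr : 0 < ∑ i, v i ^ 2 / s i) (c : ℝ) :
    loewnerLE (realPure v) (c • realDiag s) ↔ ∑ i, v i ^ 2 / s i ≤ c := by
  have hquad (w : ι → ℂ) : star w ⬝ᵥ ((c • realDiag s - realPure v).mulVec w) =
      ((c * ∑ i, s i * ‖w i‖ ^ 2 - ‖∑ i, v i * w i‖ ^ 2 : ℝ) : ℂ) := by
    have h1 : star w ⬝ᵥ (realDiag s).mulVec w = ((∑ i, s i * ‖w i‖ ^ 2 : ℝ) : ℂ) := by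
      simp only [dotProduct, realDiag, Matrix.mulVec_diagonal, Pi.star_apply]
      push_cast
      refine Finset.sum_congr rfl fun i _ => ?_
      rw [← Complex.conj_mul']
      simp only [RCLike.star_def]
      ring
    have h2 : star w ⬝ᵥ (realPure v).mulVec w = ((‖∑ i, v i * w i‖ ^ 2 : ℝ) : ℂ) := by
      push_cast
      rw [← Complex.conj_mul', realPure, Matrix.vecMulVec_mulVec, dotProduct_smul]
      simp [dotProduct, mul_comm]
    rw [Matrix.sub_mulVec, dotProduct_sub, Matrix.smul_mulVec, dotProduct_smul, h1, h2]
    simp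
  constructor
  · intro h
    have h1 := Matrix.PosSemidef.dotProduct_mulVec_nonneg h (fun i => ((v i / s i : ℝ) : ℂ))
    rw [hquad, Complex.zero_le_real] at h1
    have e1 : ∑ i, s i * ‖((v i / s i : ℝ) : ℂ)‖ ^ 2 = ∑ i, v i ^ 2 / s i :=
      Finset.sum_congr rfl fun i _ => by
        have := (hs i).ne'
        rw [Complex.norm_real, Real.norm_eq_abs, sq_abs]
        field_simp
    have e2 : ∑ i, (v i : ℂ) * ((v i / s i : ℝ) : ℂ) = ((∑ i, v i ^ 2 / s i : ℝ) : ℂ) := by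
      push_cast
      exact Finset.sum_congr rfl fun i _ => by ring
    rw [e1, e2, Complex.norm_real, Real.norm_eq_abs, sq_abs] at h1
    nlinarith
  · intro h
    refine .of_dotProduct_mulVec_nonneg ?_ fun w => ?_
    · refine ((posDef_realDiag hs).1.smul ?_).sub (posSemidef_realPure v).1
      exact IsSelfAdjoint.all c
    · rw [hquad, Complex.zero_le_real, sub_nonneg]
      have hn : ‖∑ i, (v i : ℂ) * w i‖ ≤ ∑ i, |v i| * ‖w i‖ :=
        (norm_sum_le _ _).trans_eq (Finset.sum_congr rfl fun i _ => by simp)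
      have hcs := Finset.sum_sq_le_sum_mul_sum_of_sq_le_mul Finset.univ
        (r := fun i => |v i| * ‖w i‖) (f := fun i => v i ^ 2 / s i) (g := fun i => s i * ‖w i‖ ^ 2)
        (fun i _ => div_nonneg (sq_nonneg _) (hs i).le)
        (fun i _ => mul_nonneg (hs i).le (sq_nonneg _))
        (fun i _ => by
          have := (hs i).ne'
          rw [mul_pow, sq_abs]
          field_simp
          rfl)
      calc ‖∑ i, (v i : ℂ) * w i‖ ^ 2 ≤ (∑ i, |v i| * ‖w i‖) ^ 2 := by gcongr
        _ ≤ _ := hcs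
        _ ≤ _ := by
          gcongr
          exact Finset.sum_nonneg fun i _ => mul_nonneg (hs i).le (sq_nonneg _)

theorem Dmax_realPure_realDiag {s v : ι → ℝ} (hs : ∀ i, 0 < s i)
    (hr : 0 < ∑ i, v i ^ 2 / s i) :
    Dmax (realPure v) (realDiag s) = ((Real.log (∑ i, v i ^ 2 / s i) : ℝ) : EReal) := by
  have hset : {c : ℝ | 0 < c ∧ loewnerLE (realPure v) (c • realDiag s)} =
      Set.Ici (∑ i, v i ^ 2 / s i) := by
    ext c
    simp only [loewnerLE_realPure_realDiag_iff hs hr, Set.mem_ofPred_eq, Set.mem_Ici]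
    exact ⟨And.right, fun h => ⟨hr.trans_le h, h⟩⟩
  have hex : ∃ c : ℝ, 0 < c ∧ loewnerLE (realPure v) (c • realDiag s) :=
    ⟨_, hr, (loewnerLE_realPure_realDiag_iff hs hr _).2 le_rfl⟩
  rw [Dmax, if_pos hex, hset, csInf_Ici]

theorem Daz_realPure_realDiag {s v : ι → ℝ} (hs : ∀ i, 0 < s i) (hv : ∑ i, v i ^ 2 = 1)
    {α κ : ℝ} (hα : 1 < α) (hκ : 0 < κ) (hr : 0 < ∑ i, v i ^ 2 / s i ^ κ) :
    Daz α ((α - 1) / κ) (realPure v) (realDiag s) =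
      ((κ⁻¹ * Real.log (∑ i, v i ^ 2 / s i ^ κ) : ℝ) : EReal) := by
  have hα' : α - 1 ≠ 0 := (sub_pos.2 hα).ne'
  have hsum : ∑ i, ((fun i => s i ^ ((1 - α) / (2 * ((α - 1) / κ)))) * v) i ^ 2 =
      ∑ i, v i ^ 2 / s i ^ κ := by
    refine Finset.sum_congr rfl fun i _ => ?_
    have he : (1 - α) / (2 * ((α - 1) / κ)) * (2 : ℕ) = -κ := by
      push_cast
      field_simp
      ring
    rw [Pi.mul_apply, mul_pow, ← Real.rpow_natCast (s i ^ _), ← Real.rpow_mul (hs i).le, he,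
      Real.rpow_neg (hs i).le, div_eq_mul_inv, mul_comm]
  have hQ : Qaz α ((α - 1) / κ) (realPure v) (realDiag s) =
      (∑ i, v i ^ 2 / s i ^ κ) ^ ((α - 1) / κ) := by
    rw [Qaz, matPow_realDiag hs, matPow_realPure (by rw [hv]; exact one_pos), hv, Real.one_rpow,
      one_smul, realDiag_mul_realPure_mul_realDiag, matPow_realPure (by rwa [hsum]), reTrace,
      Matrix.trace_smul, trace_realPure, hsum, Complex.real_smul, ← Complex.ofReal_mul,
      Complex.ofReal_re, Real.rpow_sub_one hr.ne', div_mul_cancel₀ _ hr.ne']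
  have hsupp : suppLE (realPure v) (realDiag s) := by
    intro w hw
    have hw0 : w = 0 := by
      funext i
      have := congrFun hw i
      rw [realDiag, Matrix.mulVec_diagonal] at this
      simpa [(hs i).ne'] using this
    simp [hw0]
  rw [Daz, if_pos ⟨.inl hsupp, by rw [hQ]; exact (Real.rpow_pos_of_pos hr _).ne'⟩, hQ,
    Real.log_rpow hr, reTrace, trace_realPure, hv]
  simp only [Complex.ofReal_one, Complex.one_re, Real.log_one, sub_zero]
  congr 1
  field_simp

theorem continuous_realPure {ι : Type*} : Continuous (realPure : (ι → ℝ) → Matrix ι ι ℂ) :=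
  Continuous.matrix_vecMulVec (by fun_prop) (by fun_prop)

theorem continuous_realDiag {ι : Type*} [DecidableEq ι] : Continuous (realDiag : (ι → ℝ) → Matrix ι ι ℂ) :=
  Continuous.matrix_diagonal (by fun_prop)

/-- Amplitudes of a unit vector with weights `1 - p` and `p` on the first two coordinates. -/
def twoLevelAmp (m : ℕ) (p : ℝ) : Fin (m + 2) → ℝ :=
  Fin.cons √(1 - p) (Fin.cons √p 0)

/-- A probability vector with mass `ε` at every coordinate but the first. -/
def nearPointMass (m : ℕ) (ε : ℝ) : Fin (m + 2) → ℝ :=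
  Fin.cons (1 - (m + 1) * ε) fun _ => ε

theorem nearPointMass_pos {m : ℕ} {ε : ℝ} (h0 : 0 < ε) (h1 : (m + 1) * ε < 1) (i) :
    0 < nearPointMass m ε i := by
  refine Fin.cases ?_ (fun j => ?_) i
  · simpa [nearPointMass] using h1
  · simpa [nearPointMass] using h0

theorem sum_nearPointMass (m : ℕ) (ε : ℝ) : ∑ i, nearPointMass m ε i = 1 := by
  simp [nearPointMass, Fin.sum_univ_succ]

theorem sum_twoLevelAmp_sq {m : ℕ} {p : ℝ} (hp0 : 0 ≤ p) (hp1 : p ≤ 1) :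
    ∑ i, twoLevelAmp m p i ^ 2 = 1 := by
  simp [twoLevelAmp, Fin.sum_univ_succ, Real.sq_sqrt hp0, Real.sq_sqrt (sub_nonneg.2 hp1)]

theorem sum_twoLevelAmp_sq_div {m : ℕ} {p : ℝ} (hp0 : 0 ≤ p) (hp1 : p ≤ 1) (ε x : ℝ) :
    ∑ i, twoLevelAmp m p i ^ 2 / nearPointMass m ε i ^ x =
      (1 - p) / (1 - (m + 1) * ε) ^ x + p / ε ^ x := by
  simp [twoLevelAmp, nearPointMass, Fin.sum_univ_succ, Real.sq_sqrt hp0,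
    Real.sq_sqrt (sub_nonneg.2 hp1)]

theorem continuous_twoLevelAmp (m : ℕ) : Continuous (twoLevelAmp m) := by
  refine continuous_pi fun i => Fin.cases ?_ (fun j => Fin.cases ?_ (fun k => ?_) j) i <;>
  · simp only [twoLevelAmp, Fin.cons_zero, Fin.cons_succ, Pi.zero_apply]
    fun_prop

theorem continuous_nearPointMass (m : ℕ) : Continuous (nearPointMass m) := by
  refine continuous_pi fun i => Fin.cases ?_ (fun j => ?_) i <;>
  · simp only [nearPointMass, Fin.cons_zero, Fin.cons_succ]
    fun_prop

theorem realPure_twoLevelAmp_zero (m : ℕ) :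
    realPure (twoLevelAmp m 0) = realDiag (nearPointMass m 0) := by
  have h : (Fin.cons 0 0 : Fin (m + 1) → ℝ) = 0 := by
    ext i
    exact Fin.cases rfl (fun _ => rfl) i
  ext i j
  rcases Fin.eq_zero_or_eq_succ i with rfl | ⟨i, rfl⟩ <;>
  rcases Fin.eq_zero_or_eq_succ j with rfl | ⟨j, rfl⟩ <;>
  simp [realPure, realDiag, twoLevelAmp, nearPointMass, Matrix.vecMulVec_apply,
    Matrix.diagonal_apply, h, (Fin.succ_ne_zero _).symm]

/-- On a space of dimension `≥ 2`, for `λ > 1` and `κ > 0` there exist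
sequences of states (`ρ_n` pure, `σ_n` full rank) with a common limit, such that
`D_max(ρ_n‖σ_n^κ) → log λ`, `D_{α,(α-1)/κ}(ρ_n‖σ_n) → κ⁻¹ log λ > 0` for all `α > 1`,
and, when `κ ∈ (0,1]`, `D_max(ρ_n‖σ_n) → log λ` (if `κ = 1`) or `+∞` (if `κ < 1`). -/
theorem exists_state_sequences_discontinuity {n : ℕ} (hn : 2 ≤ n) (lam κ : ℝ)
    (hlam : 1 < lam) (hκ : 0 < κ) :
    ∃ ρ σ : ℕ → Matrix (Fin n) (Fin n) ℂ,
      (∀ k, (ρ k).PosSemidef ∧ (ρ k).trace = 1 ∧ ρ k * ρ k = ρ k) ∧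
      (∀ k, (σ k).PosDef ∧ (σ k).trace = 1) ∧
      (∃ τ : Matrix (Fin n) (Fin n) ℂ,
        Filter.Tendsto ρ Filter.atTop (𝓝 τ) ∧ Filter.Tendsto σ Filter.atTop (𝓝 τ)) ∧
      Filter.Tendsto (fun k => Dmax (ρ k) (matPow (σ k) κ)) Filter.atTop
        (𝓝 ((Real.log lam : ℝ) : EReal)) ∧
      (∀ α : ℝ, 1 < α →
        Filter.Tendsto (fun k => Daz α ((α - 1) / κ) (ρ k) (σ k)) Filter.atTop
          (𝓝 ((κ⁻¹ * Real.log lam : ℝ) : EReal))) ∧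
      (0 : ℝ) < κ⁻¹ * Real.log lam ∧
      (κ = 1 → Filter.Tendsto (fun k => Dmax (ρ k) (σ k)) Filter.atTop
        (𝓝 ((Real.log lam : ℝ) : EReal))) ∧
      (κ < 1 → Filter.Tendsto (fun k => Dmax (ρ k) (σ k)) Filter.atTop
        (𝓝 (⊤ : EReal))) := by
  obtain ⟨m, rfl⟩ := Nat.exists_eq_add_of_le' hn
  have hlam0 : 0 < lam - 1 := sub_pos.2 hlam
  set p : ℝ → ℝ := fun ε => (lam - 1) * ε ^ κ with hp
  have hid : Tendsto (fun ε : ℝ => ε) (𝓝[>] 0) (𝓝 0) := tendsto_id.mono_left nhdsWithin_le_nhds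
  have hp0 : Tendsto p (𝓝[>] 0) (𝓝 0) := by
    have := (hid.rpow_const (p := κ) (.inr hκ.le)).const_mul (lam - 1)
    rwa [Real.zero_rpow hκ.ne', mul_zero] at this
  have ha0 : Tendsto (fun ε : ℝ => (m + 1) * ε) (𝓝[>] 0) (𝓝 0) := by
    simpa using hid.const_mul ((m : ℝ) + 1)
  obtain ⟨ε, hε, hεP⟩ : ∃ ε : ℕ → ℝ, Tendsto ε atTop (𝓝[>] 0) ∧
      ∀ k, 0 < ε k ∧ p (ε k) < 1 ∧ (m + 1) * ε k < 1 := by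
    refine exists_seq_forall_of_frequently (p := fun t => 0 < t ∧ p t < 1 ∧ (m + 1) * t < 1)
      (Eventually.frequently ?_)
    filter_upwards [self_mem_nhdsWithin, hp0.eventually_lt_const one_pos,
      ha0.eventually_lt_const one_pos] with t h1 h2 h3
    exact ⟨h1, h2, h3⟩
  have hpε (k : ℕ) : 0 < p (ε k) := mul_pos hlam0 (Real.rpow_pos_of_pos (hεP k).1 _)
  have hs (k : ℕ) := nearPointMass_pos (hεP k).1 (hεP k).2.2
  have hv (k : ℕ) := sum_twoLevelAmp_sq (m := m) (hpε k).le (hεP k).2.1.le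
  have hsum (k : ℕ) := sum_twoLevelAmp_sq_div (m := m) (hpε k).le (hεP k).2.1.le (ε k)
  have hr (k : ℕ) (x : ℝ) :
      0 < ∑ i, twoLevelAmp m (p (ε k)) i ^ 2 / nearPointMass m (ε k) i ^ x := by
    rw [hsum]
    exact add_pos (div_pos (sub_pos.2 (hεP k).2.1)
      (Real.rpow_pos_of_pos (sub_pos.2 (hεP k).2.2) _))
      (div_pos (hpε k) (Real.rpow_pos_of_pos (hεP k).1 _))
  have hfirst (x : ℝ) : Tendsto (fun k => (1 - p (ε k)) / (1 - (m + 1) * ε k) ^ x) atTop (𝓝 1) := by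
    have hnum := (hp0.comp hε).const_sub 1
    have hden := ((ha0.comp hε).const_sub 1).rpow_const (p := x) (.inl (by simp))
    simpa [Function.comp_def, Pi.div_def] using hnum.div hden (by simp)
  have hlim : Tendsto (fun k => Real.log
      (∑ i, twoLevelAmp m (p (ε k)) i ^ 2 / nearPointMass m (ε k) i ^ κ)) atTop
      (𝓝 (Real.log lam)) := by
    refine Tendsto.log ?_ (one_pos.trans hlam).ne'
    simp only [hsum]
    have := (hfirst κ).add_const (lam - 1)
    rw [add_sub_cancel] at this
    refine this.congr fun k => ?_
    rw [hp, mul_div_cancel_right₀ _ (Real.rpow_pos_of_pos (hεP k).1 _).ne']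
  have hDκ (k : ℕ) := Dmax_realPure_realDiag
    (fun i => Real.rpow_pos_of_pos (hs k i) κ) (hr k κ)
  have hD1 (k : ℕ) := Dmax_realPure_realDiag (hs k) (v := twoLevelAmp m (p (ε k)))
    (by simpa using hr k 1)
  refine ⟨fun k => realPure (twoLevelAmp m (p (ε k))), fun k => realDiag (nearPointMass m (ε k)),
    fun k => ⟨posSemidef_realPure _, by rw [trace_realPure, hv, Complex.ofReal_one],
      by rw [realPure_mul_self, hv, one_smul]⟩,
    fun k => ⟨posDef_realDiag (hs k), ?_⟩, ⟨realDiag (nearPointMass m 0), ?_, ?_⟩,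
    ?_, fun α hα => ?_, mul_pos (inv_pos.2 hκ) (Real.log_pos hlam), ?_, fun hκ1 => ?_⟩
  · change (Matrix.diagonal _).trace = _
    rw [Matrix.trace_diagonal, ← Complex.ofReal_sum, sum_nearPointMass,
      Complex.ofReal_one]
  · rw [← realPure_twoLevelAmp_zero]
    exact ((continuous_realPure.comp (continuous_twoLevelAmp m)).tendsto 0).comp (hp0.comp hε)
  · exact ((continuous_realDiag.comp (continuous_nearPointMass m)).tendsto 0).comp (hid.comp hε)
  · simp only [matPow_realDiag (hs _), hDκ]
    exact EReal.tendsto_coe.2 hlim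
  · simp only [Daz_realPure_realDiag (hs _) (hv _) hα hκ (hr _ κ)]
    exact EReal.tendsto_coe.2 (hlim.const_mul _)
  · rintro rfl
    simp only [hD1]
    simpa using EReal.tendsto_coe.2 hlim
  · simp only [hD1]
    refine EReal.tendsto_coe_nhds_top_iff.2 (Real.tendsto_log_atTop.comp ?_)
    have hsecond : Tendsto (fun k => p (ε k) / ε k ^ (1 : ℝ)) atTop atTop := by
      have := ((tendsto_rpow_neg_nhdsGT_zero (sub_neg.2 hκ1)).const_mul_atTop hlam0).comp hε
      refine this.congr fun k => ?_
      simp only [Function.comp_apply, hp]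
      rw [Real.rpow_sub (hεP k).1, mul_div_assoc]
    refine ((hfirst 1).add_atTop hsecond).congr fun k => ?_
    rw [← hsum k 1]
    simp

end QRenyi

end
end

section
/- Let κ > 0 and let f : [0,∞) → [0,∞) be a κ-function. Then for any finite-dimensional complex Hilbert space ℋ, the operator-valued function (p, q, z, ρ, σ) ↦ (σ^{−q/2} ρ^p σ^{−q/2})^z is continuous on the set C_f(ℋ) := {(p,q) ∈ (0,∞)² : q/κ < min{p, 1}} × (0,∞) × {(ρ,σ) : ρ, σ nonzero PSD operators on ℋ with ρ ≤ f(σ)}, where negative powers of σ are taken on its support. -/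
open Filter Set Topology
open scoped ComplexOrder

noncomputable section

namespace QRenyi

attribute [local instance] Classical.propDecidable

variable {ι : Type*} [Fintype ι] [DecidableEq ι]

section

open scoped Matrix.Norms.L2Operator MatrixOrder

/-- Every real function is continuous on the (finite) spectrum of a matrix. -/
lemma continuousOn_matrix_spectrum (g : ℝ → ℝ) (A : Matrix ι ι ℂ) :
    ContinuousOn g (spectrum ℝ A) :=
  A.finite_real_spectrum.continuousOn g

lemma hermApply_eq_cfc {A : Matrix ι ι ℂ} (hA : 0 ≤ A) (g : ℝ → ℝ) :
    hermApply g A = cfc g A := by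
  have h : A.IsHermitian := (Matrix.nonneg_iff_posSemidef.mp hA).isHermitian
  rw [hermApply, dif_pos h, h.cfc_eq]

lemma matPow_eq_cfc {A : Matrix ι ι ℂ} (hA : 0 ≤ A) {x : ℝ} (hx : x ≠ 0) :
    matPow A x = cfc (fun t : ℝ => t ^ x) A := by
  rw [matPow, hermApply_eq_cfc hA]
  refine cfc_congr fun t _ => ?_
  split_ifs with h
  · rw [h, Real.zero_rpow hx]
  · rfl

lemma spectrum_subset_Icc_norm {A : Matrix ι ι ℂ} (hA : 0 ≤ A) :
    spectrum ℝ A ⊆ Set.Icc 0 ‖A‖ := by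
  intro t ht
  have h := norm_apply_le_norm_cfc (id : ℝ → ℝ) A ht continuousOn_id hA.isSelfAdjoint
  rw [cfc_id ℝ A hA.isSelfAdjoint] at h
  exact ⟨spectrum_nonneg_of_nonneg hA ht, (le_abs_self t).trans h⟩

/-- Joint continuity of the functional calculus in the function and in the (positive) matrix. -/
lemma continuousWithinAt_cfc_uncurry {Y : Type*} [TopologicalSpace Y] {g : Y → ℝ → ℝ}
    {A : Y → Matrix ι ι ℂ} {s : Set Y} {y₀ : Y} (hy₀ : y₀ ∈ s)
    (hg : ContinuousOn (Function.uncurry g) (s ×ˢ Set.Ici 0))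
    (hA : ContinuousWithinAt A s y₀) (hpos : ∀ y ∈ s, 0 ≤ A y) :
    ContinuousWithinAt (fun y => cfc (g y) (A y)) s y₀ := by
  set K := Set.Icc 0 (‖A y₀‖ + 1)
  have hKc : IsCompact K := isCompact_Icc
  have hspec : ∀ᶠ y in 𝓝[s] y₀, spectrum ℝ (A y) ⊆ K := by
    filter_upwards [hA.norm.eventually (gt_mem_nhds (lt_add_one ‖A y₀‖)), self_mem_nhdsWithin]
      with y hy hys
    exact (spectrum_subset_Icc_norm (hpos y hys)).trans (Set.Icc_subset_Icc_right hy.le)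
  have hgK : ContinuousOn (Function.uncurry g) (s ×ˢ K) :=
    hg.mono (Set.prod_mono_right Set.Icc_subset_Ici_self)
  have hfix : ContinuousWithinAt (fun y => cfc (g y₀) (A y)) s y₀ := by
    refine hA.cfc hKc (g y₀) hy₀ hspec ?_ ?_
    · filter_upwards [self_mem_nhdsWithin] with y hy using (hpos y hy).isSelfAdjoint
    · exact hgK.comp (f := fun t => (y₀, t)) (by fun_prop) fun t ht => ⟨hy₀, ht⟩
  refine continuousWithinAt_of_locally_uniform_approx_of_continuousWithinAt hy₀ fun u hu => ?_
  obtain ⟨ε, hε, hεu⟩ := Metric.mem_uniformity_dist.mp hu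
  obtain ⟨v, hv, hvK⟩ := hKc.mem_uniformity_of_prod hgK hy₀ (Metric.dist_mem_uniformity hε)
  refine ⟨_, inter_mem hv hspec, _, hfix, fun y hy => hεu ?_⟩
  rw [dist_eq_norm, ← cfc_sub (g y) (g y₀) (A y) (continuousOn_matrix_spectrum _ _)
    (continuousOn_matrix_spectrum _ _)]
  exact norm_cfc_lt hε fun t ht => by
    simpa [dist_eq_norm] using hvK y hy.1 t (hy.2 ht)

/-- Joint continuity of positive powers of positive semidefinite matrices. -/
lemma continuousWithinAt_matPow {Y : Type*} [TopologicalSpace Y] {x : Y → ℝ}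
    {A : Y → Matrix ι ι ℂ} {s : Set Y} {y₀ : Y} (hy₀ : y₀ ∈ s)
    (hx : ContinuousOn x s) (hxpos : ∀ y ∈ s, 0 < x y)
    (hA : ContinuousWithinAt A s y₀) (hpos : ∀ y ∈ s, 0 ≤ A y) :
    ContinuousWithinAt (fun y => matPow (A y) (x y)) s y₀ := by
  refine (continuousWithinAt_cfc_uncurry (g := fun y t => t ^ x y) hy₀ ?_ hA hpos).congr
    (fun y hy => matPow_eq_cfc (hpos y hy) (hxpos y hy).ne')
    (matPow_eq_cfc (hpos _ hy₀) (hxpos _ hy₀).ne')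
  exact ContinuousOn.rpow continuousOn_snd
    (hx.comp continuousOn_fst fun p hp => hp.1) fun p hp => Or.inr (hxpos _ hp.1)

lemma matPow_nonneg {A : Matrix ι ι ℂ} (hA : 0 ≤ A) (x : ℝ) : 0 ≤ matPow A x := by
  rw [matPow, hermApply_eq_cfc hA]
  refine cfc_nonneg fun t ht => ?_
  split_ifs
  · exact le_rfl
  · exact Real.rpow_nonneg (spectrum_nonneg_of_nonneg hA ht) x

lemma matPow_half_mul_matPow_half {A : Matrix ι ι ℂ} (hA : 0 ≤ A) (x : ℝ) :
    matPow A (x / 2) * matPow A (x / 2) = matPow A x := by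
  simp only [matPow, hermApply_eq_cfc hA]
  rw [← cfc_mul _ _ A (continuousOn_matrix_spectrum _ _) (continuousOn_matrix_spectrum _ _)]
  refine cfc_congr fun t ht => ?_
  split_ifs with h
  · simp
  · rw [← Real.rpow_add ((spectrum_nonneg_of_nonneg hA ht).lt_of_ne' h), add_halves]

/-- A `κ`-function is dominated by a multiple of `t ^ κ` on bounded intervals. -/
lemma IsKappaFunction.exists_le_mul_rpow {κ : ℝ} (hκ : 0 < κ) {f : ℝ → ℝ}
    (hf : IsKappaFunction κ f) (R : ℝ) :
    ∃ C : ℝ, 0 ≤ C ∧ ∀ t ∈ Set.Icc 0 R, f t ≤ C * t ^ κ := by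
  obtain ⟨hcont, -, M, hM⟩ := hf
  obtain ⟨δ, hδ, hδM⟩ := mem_nhdsGT_iff_exists_Ioc_subset.mp hM
  have hδ : 0 < δ := hδ
  obtain ⟨B, hB⟩ := (isCompact_Icc (a := (0 : ℝ)) (b := R)).bddAbove_image
    (hcont.mono Set.Icc_subset_Ici_self)
  have hf0 : f 0 ≤ 0 := by
    have h1 : Tendsto f (𝓝[>] 0) (𝓝 (f 0)) :=
      (hcont 0 Set.self_mem_Ici).mono_left (nhdsWithin_mono _ Set.Ioi_subset_Ici_self)
    have h2 : Tendsto (fun x : ℝ => M * x ^ κ) (𝓝[>] 0) (𝓝 (M * 0 ^ κ)) :=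
      ((Real.continuousAt_rpow_const 0 κ (Or.inr hκ.le)).tendsto.mono_left
        nhdsWithin_le_nhds).const_mul M
    rw [Real.zero_rpow hκ.ne', mul_zero] at h2
    exact le_of_tendsto_of_tendsto h1 h2 hM
  have hδκ : 0 < δ ^ κ := Real.rpow_pos_of_pos hδ κ
  refine ⟨|M| + |B| / δ ^ κ, by positivity, fun t ht => ?_⟩
  have htκ : 0 ≤ t ^ κ := Real.rpow_nonneg ht.1 κ
  rcases ht.1.eq_or_lt with rfl | ht0
  · simpa [Real.zero_rpow hκ.ne'] using hf0
  · rw [add_mul]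
    rcases le_total t δ with h | h
    · have h1 : f t ≤ M * t ^ κ := hδM ⟨ht0, h⟩
      have h2 : M * t ^ κ ≤ |M| * t ^ κ := by gcongr; exact le_abs_self M
      have h3 : 0 ≤ |B| / δ ^ κ * t ^ κ := by positivity
      linarith
    · have h1 : f t ≤ |B| := (hB (Set.mem_image_of_mem f ht)).trans (le_abs_self B)
      have h2 : δ ^ κ ≤ t ^ κ := Real.rpow_le_rpow hδ.le h hκ.le
      have h3 : |B| ≤ |B| / δ ^ κ * t ^ κ := by
        rw [div_mul_eq_mul_div, le_div_iff₀ hδκ]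
        gcongr
      have h4 : 0 ≤ |M| * t ^ κ := by positivity
      linarith

lemma matPow_le_norm_rpow_smul {ρ : Matrix ι ι ℂ} (hρ : 0 ≤ ρ) {s p : ℝ} (hs : 0 < s)
    (hsp : s ≤ p) : matPow ρ p ≤ ‖ρ‖ ^ (p - s) • matPow ρ s := by
  rw [matPow_eq_cfc hρ (hs.trans_le hsp).ne', matPow_eq_cfc hρ hs.ne',
    ← cfc_smul _ _ ρ (continuousOn_matrix_spectrum _ _)]
  refine cfc_mono (fun t ht => ?_) (continuousOn_matrix_spectrum _ _)
    (continuousOn_matrix_spectrum _ _)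
  obtain ⟨ht0, htn⟩ := spectrum_subset_Icc_norm hρ ht
  calc t ^ p = t ^ (p - s) * t ^ s := by
        rw [← Real.rpow_add_of_nonneg ht0 (sub_nonneg.mpr hsp) hs.le, sub_add_cancel]
    _ ≤ ‖ρ‖ ^ (p - s) * t ^ s := by
        have := Real.rpow_le_rpow ht0 htn (sub_nonneg.mpr hsp)
        gcongr

/-- If `ρ ≤ C σ ^ κ`, then `ρ ^ p` is dominated by a multiple of `σ ^ (κ s)` for all `s ≤ 1`
and `s ≤ p`, by operator monotonicity of `t ↦ t ^ s`. -/
lemma matPow_le_of_le_cfc {ρ σ : Matrix ι ι ℂ} (hρ : 0 ≤ ρ) (hσ : 0 ≤ σ) {C κ s p : ℝ}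
    (hC : 0 ≤ C) (hs : 0 < s) (hs1 : s ≤ 1) (hsp : s ≤ p)
    (h : ρ ≤ cfc (fun t : ℝ => C * t ^ κ) σ) :
    matPow ρ p ≤ cfc (fun t : ℝ => ‖ρ‖ ^ (p - s) * C ^ s * t ^ (κ * s)) σ := by
  set τ := cfc (fun t : ℝ => C * t ^ κ) σ
  have hτ : 0 ≤ τ := hρ.trans h
  have hmono : matPow ρ s ≤ matPow τ s := by
    have := CFC.rpow_le_rpow (p := s) ⟨hs.le, hs1⟩ h
    rwa [CFC.rpow_eq_cfc_real hρ, CFC.rpow_eq_cfc_real hτ, ← matPow_eq_cfc hρ hs.ne',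
      ← matPow_eq_cfc hτ hs.ne'] at this
  have hτs : matPow τ s = cfc (fun t : ℝ => C ^ s * t ^ (κ * s)) σ := by
    rw [matPow_eq_cfc hτ hs.ne', ← cfc_comp' (fun t : ℝ => t ^ s) (fun t : ℝ => C * t ^ κ) σ
      ((σ.finite_real_spectrum.image _).continuousOn _) (continuousOn_matrix_spectrum _ _)]
    refine cfc_congr fun t ht => ?_
    have ht0 := spectrum_nonneg_of_nonneg hσ ht
    rw [Real.mul_rpow hC (Real.rpow_nonneg ht0 κ), ← Real.rpow_mul ht0]
  calc matPow ρ p ≤ ‖ρ‖ ^ (p - s) • matPow ρ s := matPow_le_norm_rpow_smul hρ hs hsp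
    _ ≤ ‖ρ‖ ^ (p - s) • matPow τ s :=
        smul_le_smul_of_nonneg_left hmono (Real.rpow_nonneg (norm_nonneg ρ) _)
    _ = _ := by
        rw [hτs, ← cfc_smul _ _ σ (continuousOn_matrix_spectrum _ _)]
        simp only [smul_eq_mul, mul_assoc]

/-- `D ρ ^ p D` is the squared modulus of `ρ ^ (p / 2) D` for self-adjoint `D`. -/
lemma conj_matPow_eq_star_mul_self {ρ D : Matrix ι ι ℂ} (hρ : 0 ≤ ρ) (hD : IsSelfAdjoint D)
    (p : ℝ) : D * matPow ρ p * D = star (matPow ρ (p / 2) * D) * (matPow ρ (p / 2) * D) := by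
  rw [star_mul, (matPow_nonneg hρ _).isSelfAdjoint.star_eq, hD.star_eq,
    ← matPow_half_mul_matPow_half hρ p]
  simp only [mul_assoc]

lemma norm_matPow_half_mul_cfc_sq_le {ρ σ : Matrix ι ι ℂ} (hρ : 0 ≤ ρ) (hσ : 0 ≤ σ)
    {p b : ℝ} (hb : 0 ≤ b) {d g : ℝ → ℝ} (h : matPow ρ p ≤ cfc g σ)
    (hd : ∀ t, 0 ≤ t → d t * g t * d t ≤ b) :
    ‖matPow ρ (p / 2) * cfc d σ‖ ^ 2 ≤ b := by
  have hdsa : IsSelfAdjoint (cfc d σ) := cfc_predicate d σ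
  have hle : cfc d σ * matPow ρ p * cfc d σ ≤ algebraMap ℝ _ b := by
    refine (hdsa.conjugate_le_conjugate h).trans ?_
    rw [← cfc_mul d g σ (continuousOn_matrix_spectrum _ _) (continuousOn_matrix_spectrum _ _),
      ← cfc_mul _ d σ (continuousOn_matrix_spectrum _ _) (continuousOn_matrix_spectrum _ _)]
    exact cfc_le_algebraMap _ _ σ (fun t ht => hd t (spectrum_nonneg_of_nonneg hσ ht))
      (continuousOn_matrix_spectrum _ _) hσ.isSelfAdjoint
  rw [sq, ← CStarRing.norm_star_mul_self, ← conj_matPow_eq_star_mul_self hρ hdsa]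
  exact (CStarAlgebra.norm_le_iff_le_algebraMap _ hb
    (hdsa.conjugate_nonneg (matPow_nonneg hρ p))).mpr hle

/-- Replacing `t ^ (-q / 2)` by its truncation at `ε` costs little against the weight `t ^ r`. -/
lemma truncation_error_le {q r ε D : ℝ} (hq : 0 < q) (hqr : q < r) (hε : 0 < ε) (hD : 0 ≤ D)
    {t : ℝ} (ht : 0 ≤ t) :
    ((if t = 0 then 0 else t ^ (-q / 2)) - max t ε ^ (-q / 2)) * (D * t ^ r) *
      ((if t = 0 then 0 else t ^ (-q / 2)) - max t ε ^ (-q / 2)) ≤ D * ε ^ (r - q) := by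
  have hεr : 0 ≤ D * ε ^ (r - q) := by positivity
  rcases ht.eq_or_lt with rfl | ht0
  · simpa [Real.zero_rpow (hq.trans hqr).ne'] using hεr
  rw [if_neg ht0.ne']
  rcases le_total ε t with h | h
  · simpa [max_eq_left h] using hεr
  rw [max_eq_right h]
  have h1 : ε ^ (-q / 2) ≤ t ^ (-q / 2) :=
    Real.rpow_le_rpow_of_nonpos ht0 h (by linarith)
  have h2 : 0 ≤ ε ^ (-q / 2) := by positivity
  have h3 : (t ^ (-q / 2) - ε ^ (-q / 2)) * (t ^ (-q / 2) - ε ^ (-q / 2)) ≤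
      t ^ (-q / 2) * t ^ (-q / 2) := by
    apply mul_self_le_mul_self <;> linarith
  calc _ = D * t ^ r * ((t ^ (-q / 2) - ε ^ (-q / 2)) * (t ^ (-q / 2) - ε ^ (-q / 2))) := by ring
    _ ≤ D * t ^ r * (t ^ (-q / 2) * t ^ (-q / 2)) := by gcongr
    _ = D * t ^ (r - q) := by
        rw [mul_assoc, ← Real.rpow_add ht0, ← Real.rpow_add ht0]
        ring_nf
    _ ≤ D * ε ^ (r - q) := by
        have := Real.rpow_le_rpow ht0.le h (sub_pos.mpr hqr).le
        gcongr

/-- The factor `X = ρ ^ (p / 2) σ ^ (-q / 2)` of `σ ^ (-q / 2) ρ ^ p σ ^ (-q / 2) = star X * X` is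
continuous: it is a locally uniform limit of its truncations `ρ ^ (p / 2) (max σ ε) ^ (-q / 2)`. -/
lemma continuousWithinAt_matPow_mul_matPow_neg {Y : Type*} [TopologicalSpace Y] {κ : ℝ}
    (hκ : 0 < κ) {f : ℝ → ℝ} (hf : IsKappaFunction κ f) {p q : Y → ℝ}
    {ρ σ : Y → Matrix ι ι ℂ} {S : Set Y} {y₀ : Y} (hy₀ : y₀ ∈ S)
    (hp : ContinuousOn p S) (hq : ContinuousOn q S)
    (hρ : ContinuousWithinAt ρ S y₀) (hσ : ContinuousWithinAt σ S y₀)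
    (hp_pos : ∀ y ∈ S, 0 < p y) (hq_pos : ∀ y ∈ S, 0 < q y)
    (hqp : ∀ y ∈ S, q y / κ < min (p y) 1)
    (hρ_nonneg : ∀ y ∈ S, 0 ≤ ρ y) (hσ_nonneg : ∀ y ∈ S, 0 ≤ σ y)
    (hle : ∀ y ∈ S, ρ y ≤ hermApply f (σ y)) :
    ContinuousWithinAt (fun y => matPow (ρ y) (p y / 2) * matPow (σ y) (-q y / 2)) S y₀ := by
  obtain ⟨s, hqs, hs⟩ := exists_between (hqp y₀ hy₀)
  obtain ⟨hsp, hs1⟩ := lt_min_iff.mp hs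
  have hs0 : 0 < s := (div_pos (hq_pos y₀ hy₀) hκ).trans hqs
  obtain ⟨c, hqc, hcs⟩ := exists_between ((div_lt_iff₀' hκ).mp hqs)
  obtain ⟨C, hC, hCf⟩ := hf.exists_le_mul_rpow hκ (‖σ y₀‖ + 1)
  set D := (‖ρ y₀‖ + 1) ^ (p y₀ + 1 - s) * C ^ s with hDdef
  have hD : 0 ≤ D := by positivity
  have hbound : ∀ᶠ y in 𝓝[S] y₀, q y < c ∧
      matPow (ρ y) (p y) ≤ cfc (fun t : ℝ => D * t ^ (κ * s)) (σ y) := by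
    filter_upwards [self_mem_nhdsWithin, (hq y₀ hy₀).eventually (gt_mem_nhds hqc),
      (hp y₀ hy₀).eventually (lt_mem_nhds hsp),
      (hp y₀ hy₀).eventually (gt_mem_nhds (lt_add_one (p y₀))),
      hρ.norm.eventually (gt_mem_nhds (lt_add_one ‖ρ y₀‖)),
      hσ.norm.eventually (gt_mem_nhds (lt_add_one ‖σ y₀‖))] with y hy hyq hys hyp hyρ hyσ
    refine ⟨hyq, ?_⟩
    have h1 : ρ y ≤ cfc (fun t : ℝ => C * t ^ κ) (σ y) := by
      refine (hle y hy).trans ?_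
      rw [hermApply_eq_cfc (hσ_nonneg y hy)]
      refine cfc_mono (fun t ht => hCf t ?_) (continuousOn_matrix_spectrum _ _)
        (continuousOn_matrix_spectrum _ _)
      exact Set.Icc_subset_Icc_right hyσ.le (spectrum_subset_Icc_norm (hσ_nonneg y hy) ht)
    refine (matPow_le_of_le_cfc (hρ_nonneg y hy) (hσ_nonneg y hy) hC hs0 hs1.le hys.le h1).trans ?_
    refine cfc_mono (fun t ht => ?_) (continuousOn_matrix_spectrum _ _)
      (continuousOn_matrix_spectrum _ _)
    have ht0 := spectrum_nonneg_of_nonneg (hσ_nonneg y hy) ht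
    have h2 : ‖ρ y‖ ^ (p y - s) ≤ (‖ρ y₀‖ + 1) ^ (p y₀ + 1 - s) :=
      (Real.rpow_le_rpow (norm_nonneg _) hyρ.le (by linarith)).trans
        (Real.rpow_le_rpow_of_exponent_le (by linarith [norm_nonneg (ρ y₀)]) (by linarith))
    have h3 := Real.rpow_nonneg ht0 (κ * s)
    have h4 := Real.rpow_nonneg hC s
    rw [hDdef]
    gcongr
  refine continuousWithinAt_of_locally_uniform_approx_of_continuousWithinAt hy₀ fun u hu => ?_
  obtain ⟨e, he, heu⟩ := Metric.mem_uniformity_dist.mp hu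
  obtain ⟨ε, ⟨hε, hε1⟩, hεe⟩ : ∃ ε ∈ Set.Ioo (0 : ℝ) 1, D * ε ^ (κ * s - c) < e ^ 2 := by
    have hlim : Tendsto (fun x : ℝ => D * x ^ (κ * s - c)) (𝓝[>] 0) (𝓝 (D * 0 ^ (κ * s - c))) :=
      ((Real.continuousAt_rpow_const 0 _ (Or.inr (sub_pos.mpr hcs).le)).tendsto.mono_left
        nhdsWithin_le_nhds).const_mul D
    rw [Real.zero_rpow (sub_pos.mpr hcs).ne', mul_zero] at hlim
    have := (hlim.eventually (gt_mem_nhds (pow_pos he 2))).and (Ioo_mem_nhdsGT one_pos)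
    obtain ⟨ε, h1, h2⟩ := this.exists
    exact ⟨ε, h2, h1⟩
  refine ⟨_, inter_mem self_mem_nhdsWithin hbound,
    fun y => matPow (ρ y) (p y / 2) * cfc (fun t : ℝ => max t ε ^ (-q y / 2)) (σ y), ?_,
    fun y hy => heu ?_⟩
  · refine (continuousWithinAt_matPow hy₀ (hp.div_const 2) (fun y hy => half_pos (hp_pos y hy))
      hρ hρ_nonneg).mul (continuousWithinAt_cfc_uncurry (g := fun y t => max t ε ^ (-q y / 2))
        hy₀ ?_ hσ hσ_nonneg)
    refine ContinuousOn.rpow (by fun_prop)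
      ((hq.neg.div_const 2).comp continuousOn_fst fun z hz => hz.1) fun z _ => Or.inl ?_
    exact (hε.trans_le (le_max_right _ _)).ne'
  · obtain ⟨hyS, hyq, hyle⟩ := hy
    have hpos : 0 < κ * s - q y := by linarith
    rw [dist_eq_norm, ← mul_sub, matPow, matPow, hermApply_eq_cfc (hσ_nonneg y hyS),
      ← cfc_sub _ _ (σ y) (continuousOn_matrix_spectrum _ _) (continuousOn_matrix_spectrum _ _),
      ← matPow]
    refine lt_of_pow_lt_pow_left₀ 2 he.le (lt_of_le_of_lt ?_ hεe)
    refine (norm_matPow_half_mul_cfc_sq_le (hρ_nonneg y hyS) (hσ_nonneg y hyS) (by positivity) hyle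
      fun t ht => truncation_error_le (hq_pos y hyS) (by linarith) hε hD ht).trans ?_
    exact mul_le_mul_of_nonneg_left
      (Real.rpow_le_rpow_of_exponent_ge hε hε1.le (by linarith)) hD

lemma continuousWithinAt_matPow_sandwich {Y : Type*} [TopologicalSpace Y] {κ : ℝ}
    (hκ : 0 < κ) {f : ℝ → ℝ} (hf : IsKappaFunction κ f) {p q z : Y → ℝ}
    {ρ σ : Y → Matrix ι ι ℂ} {S : Set Y} {y₀ : Y} (hy₀ : y₀ ∈ S)
    (hp : ContinuousOn p S) (hq : ContinuousOn q S) (hz : ContinuousOn z S)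
    (hρ : ContinuousWithinAt ρ S y₀) (hσ : ContinuousWithinAt σ S y₀)
    (hp_pos : ∀ y ∈ S, 0 < p y) (hq_pos : ∀ y ∈ S, 0 < q y) (hz_pos : ∀ y ∈ S, 0 < z y)
    (hqp : ∀ y ∈ S, q y / κ < min (p y) 1)
    (hρ_psd : ∀ y ∈ S, (ρ y).PosSemidef) (hσ_psd : ∀ y ∈ S, (σ y).PosSemidef)
    (hle : ∀ y ∈ S, loewnerLE (ρ y) (hermApply f (σ y))) :
    ContinuousWithinAt (fun y => matPow (matPow (σ y) (-q y / 2) * matPow (ρ y) (p y) *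
      matPow (σ y) (-q y / 2)) (z y)) S y₀ := by
  have hρ0 : ∀ y ∈ S, 0 ≤ ρ y := fun y hy => (hρ_psd y hy).nonneg
  have hσ0 : ∀ y ∈ S, 0 ≤ σ y := fun y hy => (hσ_psd y hy).nonneg
  have hσ_sa : ∀ y ∈ S, IsSelfAdjoint (matPow (σ y) (-q y / 2)) := fun y hy =>
    (matPow_nonneg (hσ0 y hy) _).isSelfAdjoint
  have hX := continuousWithinAt_matPow_mul_matPow_neg hκ hf hy₀ hp hq hρ hσ hp_pos hq_pos hqp
    hρ0 hσ0 fun y hy => Matrix.le_iff.mpr (hle y hy)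
  refine continuousWithinAt_matPow hy₀ hz hz_pos ?_ fun y hy => ?_
  · exact (hX.star.mul hX).congr
      (fun y hy => conj_matPow_eq_star_mul_self (hρ0 y hy) (hσ_sa y hy) _)
      (conj_matPow_eq_star_mul_self (hρ0 _ hy₀) (hσ_sa _ hy₀) _)
  · rw [conj_matPow_eq_star_mul_self (hρ0 y hy) (hσ_sa y hy)]
    exact star_mul_self_nonneg _

end

/-- **Theorem main.** For a `κ`-function `f`, the operator-valued map
`(p, q, z, ρ, σ) ↦ (σ^{-q/2} ρ^p σ^{-q/2})^z` is continuous on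
`{(p,q) : q/κ < min{p,1}} × (0,∞) × {(ρ,σ) : ρ, σ nonzero PSD, ρ ≤ f(σ)}`. -/
theorem operator_power_continuousOn {n : ℕ} (κ : ℝ) (hκ : 0 < κ)
    (f : ℝ → ℝ) (hf : IsKappaFunction κ f) :
    ContinuousOn
      (fun x : ℝ × ℝ × ℝ × Matrix (Fin n) (Fin n) ℂ × Matrix (Fin n) (Fin n) ℂ =>
        matPow (matPow x.2.2.2.2 (-x.2.1 / 2) * matPow x.2.2.2.1 x.1 *
          matPow x.2.2.2.2 (-x.2.1 / 2)) x.2.2.1)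
      {x : ℝ × ℝ × ℝ × Matrix (Fin n) (Fin n) ℂ × Matrix (Fin n) (Fin n) ℂ |
        0 < x.1 ∧ 0 < x.2.1 ∧ x.2.1 / κ < min x.1 1 ∧ 0 < x.2.2.1 ∧
        PSDne x.2.2.2.1 ∧ PSDne x.2.2.2.2 ∧
        loewnerLE x.2.2.2.1 (hermApply f x.2.2.2.2)} := by
  intro y₀ hy₀
  have H := continuousWithinAt_matPow_sandwich
    (Y := ℝ × ℝ × ℝ × Matrix (Fin n) (Fin n) ℂ × Matrix (Fin n) (Fin n) ℂ) hκ hf hy₀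
    (p := fun y => y.1) (q := fun y => y.2.1) (z := fun y => y.2.2.1)
    (ρ := fun y => y.2.2.2.1) (σ := fun y => y.2.2.2.2)
    continuous_fst.continuousOn continuous_snd.fst.continuousOn
    continuous_snd.snd.fst.continuousOn continuous_snd.snd.snd.fst.continuousWithinAt
    continuous_snd.snd.snd.snd.continuousWithinAt
  exact H (fun y hy => hy.1) (fun y hy => hy.2.1) (fun y hy => hy.2.2.2.1) (fun y hy => hy.2.2.1)
    (fun y hy => hy.2.2.2.2.1.1) (fun y hy => hy.2.2.2.2.2.1.1) (fun y hy => hy.2.2.2.2.2.2)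

end QRenyi

end
end
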